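/- Let T be a C_{2,ϖ} orientation-preserving circle diffeomorphism whose irrational rotation number ρ = [k₁,k₂,…] is of polynomial type, i.e. there exist ν > 0 and c > 0 with k_{n+1} ≤ c·nᵛ for all n ≥ 1. If ∫₀¹ (log(1/y))ᵛ · ϖ(y)/y dy < +∞, then T admits a C¹ conjugacy to the rigid rotation R_ρ. -/

import Mathlib

/-- A modulus of continuity. -/
structure IsModulus (w : ℝ → ℝ) : Prop where
  pos : ∀ x : ℝ, 0 < x → 0 < w x
  strictMono : StrictMonoOn w (Set.Ioi 0)
  continuous : ContinuousOn w (Set.Ioi 0)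
  subadd : ∀ x y : ℝ, 0 < x → 0 < y → w (x + y) ≤ w x + w y
  tendsto : Filter.Tendsto w (nhdsWithin 0 (Set.Ioi 0)) (nhds 0)

section

open Filter Topology Set

/-- The part of the theory of continued fractions used below: `q n` are denominators and `p n`
numerators of a sequence of best approximations to `ρ`, alternating around `ρ`. -/
structure IsConvergents (ρ : ℝ) (q p : ℕ → ℕ) : Prop where
  pos : ∀ n, 0 < q n
  mono : ∀ n, q n ≤ q (n + 1)
  add_le : ∀ n, q (n + 1) + q n ≤ q (n + 2)
  sign : ∀ n, (0 < q n * ρ - p n ∧ q (n + 1) * ρ - p (n + 1) < 0 ∧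
      0 < q (n + 2) * ρ - p (n + 2) ∧
      q (n + 2) * ρ - p (n + 2) ≤ (q n * ρ - p n) + (q (n + 1) * ρ - p (n + 1))) ∨
    (q n * ρ - p n < 0 ∧ 0 < q (n + 1) * ρ - p (n + 1) ∧
      q (n + 2) * ρ - p (n + 2) < 0 ∧
      (q n * ρ - p n) + (q (n + 1) * ρ - p (n + 1)) ≤ q (n + 2) * ρ - p (n + 2))
  abs_le_one : ∀ n, |q n * ρ - p n| ≤ 1
  best : ∀ n (d m : ℤ), 0 < d → d < q (n + 1) → |q n * ρ - p n| ≤ |d * ρ - m|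

theorem convergents_det {k p q : ℕ → ℕ} (hp0 : p 0 = 0) (hp1 : p 1 = 1) (hq0 : q 0 = 1)
    (hprec : ∀ n, p (n + 2) = k (n + 2) * p (n + 1) + p n)
    (hqrec : ∀ n, q (n + 2) = k (n + 2) * q (n + 1) + q n) (n : ℕ) :
    (p (n + 1) * q n - p n * q (n + 1) : ℤ) = (-1) ^ n := by
  induction n with
  | zero => simp [hp0, hp1, hq0]
  | succ n ih =>
    rw [hprec, hqrec, pow_succ, ← ih]
    push_cast
    ring

theorem isConvergents_of_recurrence {ρ : ℝ} {k p q : ℕ → ℕ} (hρ : ρ ∈ Ioo (0 : ℝ) 1)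
    (hk : ∀ n, 1 ≤ k (n + 1))
    (hp0 : p 0 = 0) (hp1 : p 1 = 1) (hq0 : q 0 = 1) (hq1 : q 1 = k 1)
    (hprec : ∀ n, p (n + 2) = k (n + 2) * p (n + 1) + p n)
    (hqrec : ∀ n, q (n + 2) = k (n + 2) * q (n + 1) + q n)
    (hconv : Tendsto (fun n => (p n : ℝ) / (q n : ℝ)) atTop (𝓝 ρ)) :
    IsConvergents ρ q p := by
  have hdet := convergents_det hp0 hp1 hq0 hprec hqrec
  have hpos : ∀ n, 0 < q n := by
    intro n
    induction n using Nat.strong_induction_on with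
    | _ n ih =>
      match n, ih with
      | 0, _ => omega
      | 1, _ => have := hk 0; simp at this; omega
      | n + 2, ih =>
        have := ih n (by omega)
        rw [hqrec]; omega
  have hadd : ∀ n, q (n + 1) + q n ≤ q (n + 2) := by
    intro n
    rw [hqrec]
    have := Nat.mul_le_mul_right (q (n + 1)) (hk (n + 1))
    simp only [one_mul, Nat.add_assoc, Nat.reduceAdd] at this
    omega
  have hmono : ∀ n, q n ≤ q (n + 1) := by
    rintro (_ | n)
    · have := hk 0; simp at this; simp; omega
    · show q (n + 1) ≤ q (n + 2)
      have := hadd n; omega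
  have hposR : ∀ n, (0 : ℝ) < q n := fun n => by exact_mod_cast hpos n
  have hdetR : ∀ n, (p (n + 1) * q n - p n * q (n + 1) : ℝ) = (-1) ^ n := by
    intro n; exact_mod_cast hdet n
  have hstep : ∀ n, (-1 : ℝ) ^ n * (p n / q n) < (-1) ^ n * (p (n + 2) / q (n + 2)) := by
    intro n
    have h1 : (p (n + 2) / q (n + 2) - p n / q n : ℝ) =
        (-1) ^ n * (k (n + 2) / (q n * q (n + 2))) := by
      have := hposR n
      have := hposR (n + 2)
      rw [← hdetR n]
      field_simp
      rw [hprec, hqrec]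
      push_cast
      ring
    have h2 : (0 : ℝ) < k (n + 2) / (q n * q (n + 2)) := by
      have := hposR n
      have := hposR (n + 2)
      have : (0 : ℝ) < k (n + 2) := by exact_mod_cast hk (n + 1)
      positivity
    have h3 : (-1 : ℝ) ^ n * (p (n + 2) / q (n + 2)) - (-1) ^ n * (p n / q n) =
        k (n + 2) / (q n * q (n + 2)) := by
      rw [← mul_sub, h1, ← mul_assoc, ← pow_add, Even.neg_one_pow ⟨n, rfl⟩, one_mul]
    linarith
  have halt : ∀ n, 0 < (-1 : ℝ) ^ n * (q n * ρ - p n) := by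
    intro n
    have hmon : StrictMono (fun m : ℕ => (-1 : ℝ) ^ n * ((p (n + 2 * m) : ℝ) / q (n + 2 * m))) := by
      refine strictMono_nat_of_lt_succ fun m => ?_
      have := hstep (n + 2 * m)
      rwa [pow_add, pow_mul, neg_one_sq, one_pow, mul_one] at this
    have ht : Tendsto (fun m : ℕ => (-1 : ℝ) ^ n * ((p (n + 2 * m) : ℝ) / q (n + 2 * m))) atTop
        (𝓝 ((-1) ^ n * ρ)) := by
      refine (hconv.comp (tendsto_atTop_mono (fun m => ?_) tendsto_id)).const_mul _
      simp only [id]; omega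
    have h1 := hmon.monotone.ge_of_tendsto ht 1
    have h2 := hmon (zero_lt_one)
    have h3 : (-1 : ℝ) ^ n * (p n / q n) < (-1) ^ n * ρ := by
      simpa using h2.trans_le h1
    have h4 := hposR n
    have h5 : (-1 : ℝ) ^ n * (q n * ρ - p n) =
        q n * ((-1) ^ n * ρ - (-1 : ℝ) ^ n * (p n / q n)) := by
      field_simp
    rw [h5]
    exact mul_pos h4 (by linarith)
  have hrec : ∀ n, (q (n + 2) * ρ - p (n + 2) : ℝ) =
      k (n + 2) * (q (n + 1) * ρ - p (n + 1)) + (q n * ρ - p n) := by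
    intro n
    rw [hprec, hqrec]
    push_cast
    ring
  have hsign : ∀ n, (0 < q n * ρ - p n ∧ q (n + 1) * ρ - p (n + 1) < 0 ∧
      0 < q (n + 2) * ρ - p (n + 2) ∧
      q (n + 2) * ρ - p (n + 2) ≤ (q n * ρ - p n) + (q (n + 1) * ρ - p (n + 1))) ∨
    (q n * ρ - p n < 0 ∧ 0 < q (n + 1) * ρ - p (n + 1) ∧
      q (n + 2) * ρ - p (n + 2) < 0 ∧
      (q n * ρ - p n) + (q (n + 1) * ρ - p (n + 1)) ≤ q (n + 2) * ρ - p (n + 2)) := by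
    intro n
    have h0 := halt n
    have h1 := halt (n + 1)
    have h2 := halt (n + 2)
    have hk' : (1 : ℝ) ≤ k (n + 2) := by exact_mod_cast hk (n + 1)
    rw [pow_succ] at h1
    rw [pow_add, neg_one_sq, mul_one] at h2
    rcases neg_one_pow_eq_or ℝ n with h | h <;> rw [h] at h0 h1 h2
    · left
      refine ⟨by linarith, by linarith, by linarith, ?_⟩
      rw [hrec n]
      nlinarith
    · right
      refine ⟨by linarith, by linarith, by linarith, ?_⟩
      rw [hrec n]
      nlinarith
  have habs : ∀ n, |(q n * ρ - p n : ℝ)| ≤ 1 := by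
    intro n
    induction n with
    | zero => simp [hp0, hq0, abs_of_pos hρ.1, hρ.2.le]
    | succ n ih =>
      refine le_trans ?_ ih
      rcases hsign n with ⟨h0, h1, h2, h3⟩ | ⟨h0, h1, h2, h3⟩
      · rw [abs_of_pos h0, abs_of_neg h1]; linarith
      · rw [abs_of_neg h0, abs_of_pos h1]; linarith
  refine ⟨hpos, hmono, hadd, hsign, habs, fun n d m hd hdq => ?_⟩
  obtain ⟨u, v, hu, hv⟩ : ∃ u v : ℤ, d = u * q (n + 1) + v * q n ∧
      m = u * p (n + 1) + v * p n := by
    refine ⟨-(-1) ^ n * (p n * d - q n * m), (-1) ^ n * (p (n + 1) * d - q (n + 1) * m), ?_, ?_⟩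
    · have h := hdet n
      have h' : ((-1 : ℤ) ^ n) * (-1) ^ n = 1 := by
        rw [← pow_add, Even.neg_one_pow ⟨n, rfl⟩]
      linear_combination (-d) * h' + (-1) ^ n * (-d) * h
    · have h := hdet n
      have h' : ((-1 : ℤ) ^ n) * (-1) ^ n = 1 := by
        rw [← pow_add, Even.neg_one_pow ⟨n, rfl⟩]
      linear_combination (-m) * h' + (-1) ^ n * (-m) * h
  have hq0' : (0 : ℤ) < q n := by exact_mod_cast hpos n
  have hq1' : (0 : ℤ) < q (n + 1) := by exact_mod_cast hpos (n + 1)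
  have hval : (d * ρ - m : ℝ) =
      u * (q (n + 1) * ρ - p (n + 1)) + v * (q n * ρ - p n) := by
    rw [hu, hv]
    push_cast
    ring
  rw [hval]
  have hv0 : v ≠ 0 := by
    rintro rfl
    simp only [zero_mul, add_zero] at hu
    rcases le_or_gt u 0 with h | h <;> nlinarith
  rcases lt_or_gt_of_ne hv0 with hneg | hpos'
  · have hu0 : (0 : ℝ) ≤ u := by
      have : 0 ≤ u := by by_contra! h; nlinarith
      exact_mod_cast this
    have hv1 : (v : ℝ) ≤ -1 := by exact_mod_cast (by omega : v ≤ -1)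
    rcases hsign n with ⟨h0, h1, -⟩ | ⟨h0, h1, -⟩
    · rw [abs_of_pos h0]
      refine le_trans ?_ (neg_le_abs _)
      nlinarith
    · rw [abs_of_neg h0]
      refine le_trans ?_ (le_abs_self _)
      nlinarith
  · have hu0 : (u : ℝ) ≤ 0 := by
      have : u ≤ 0 := by by_contra! h; nlinarith
      exact_mod_cast this
    have hv1 : (1 : ℝ) ≤ v := by exact_mod_cast (by omega : 1 ≤ v)
    rcases hsign n with ⟨h0, h1, -⟩ | ⟨h0, h1, -⟩
    · rw [abs_of_pos h0]
      refine le_trans ?_ (le_abs_self _)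
      nlinarith
    · rw [abs_of_neg h0]
      refine le_trans ?_ (neg_le_abs _)
      nlinarith

theorem iterate_add_int {F : ℝ → ℝ} (hFp : ∀ x, F (x + 1) = F x + 1) (i : ℕ) (x : ℝ) (m : ℤ) :
    F^[i] (x + m) = F^[i] x + m := by
  have h1 : ∀ (x : ℝ) (m : ℤ), F (x + m) = F x + m := by
    intro x m
    induction m using Int.induction_on with
    | zero => simp
    | succ m ih => push_cast at ih ⊢; rw [← add_assoc, hFp, ih, add_assoc]
    | pred m ih =>
      have := hFp (x + ((-(m : ℤ) - 1 : ℤ) : ℝ))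
      push_cast at ih this ⊢
      rw [show x + (-(m : ℝ) - 1) + 1 = x + -(m : ℝ) by ring, ih] at this
      linarith
  induction i with
  | zero => rfl
  | succ i ih => rw [Function.iterate_succ_apply', Function.iterate_succ_apply', ih, h1]

/-- The iterates of `F`, up to integer translations, are ordered as those of the rotation. -/
def OrderedAsRotation (F : ℝ → ℝ) (ρ : ℝ) : Prop :=
  ∀ (i j : ℕ) (m l : ℤ) (x : ℝ), F^[i] x + m ≤ F^[j] x + l ↔ i * ρ + m ≤ j * ρ + l

theorem OrderedAsRotation.lt_iff {F : ℝ → ℝ} {ρ : ℝ} (h : OrderedAsRotation F ρ) (i j : ℕ)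
    (m l : ℤ) (x : ℝ) : F^[i] x + m < F^[j] x + l ↔ i * ρ + m < j * ρ + l := by
  rw [← not_le, ← not_le, h]

theorem orderedAsRotation_of_rotationNumber {F : ℝ → ℝ} {ρ : ℝ} (hF : StrictMono F)
    (hFp : ∀ x, F (x + 1) = F x + 1) (hirr : Irrational ρ)
    (hrot : ∀ x : ℝ, Tendsto (fun n : ℕ => (F^[n] x - x) / (n : ℝ)) atTop (𝓝 ρ)) :
    OrderedAsRotation F ρ := by
  let f : CircleDeg1Lift := ⟨⟨F, hF.monotone⟩, hFp⟩
  have hf : ∀ n x, (f ^ n) x = F^[n] x := fun n x => by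
    rw [CircleDeg1Lift.coe_pow]; rfl
  have hτ : CircleDeg1Lift.translationNumber f = ρ := by
    refine tendsto_nhds_unique (f.tendsto_translationNumber 0) ?_
    simpa only [hf] using hrot 0
  have key : ∀ (d : ℕ) (m : ℤ) (x : ℝ), (d + 1) * ρ < m ∧ F^[d + 1] x < x + m ∨
      (m : ℝ) < (d + 1) * ρ ∧ x + m < F^[d + 1] x := by
    intro d m x
    have hd : CircleDeg1Lift.translationNumber (f ^ (d + 1)) = (d + 1) * ρ := by
      rw [CircleDeg1Lift.translationNumber_pow, hτ]
      push_cast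
      rfl
    have hne : ((d + 1 : ℕ) : ℝ) * ρ ≠ m := (hirr.natCast_mul (Nat.succ_ne_zero d)).ne_int _
    push_cast at hne
    rw [← hf]
    rcases lt_or_gt_of_ne hne with h | h
    · exact .inl ⟨h, (f ^ (d + 1)).map_lt_of_translationNumber_lt_int (by rwa [hd]) x⟩
    · exact .inr ⟨h, (f ^ (d + 1)).lt_map_of_int_lt_translationNumber (by rwa [hd]) x⟩
  intro i j m l x
  rcases lt_trichotomy i j with hij | rfl | hij
  · obtain ⟨d, rfl⟩ := Nat.exists_eq_add_of_lt hij
    have := key d (m - l) (F^[i] x)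
    rw [← Function.iterate_add_apply, show d + 1 + i = i + d + 1 by ring] at this
    push_cast at this ⊢
    rcases this with h | h <;> constructor <;> intro h' <;> linarith
  · simp
  · obtain ⟨d, rfl⟩ := Nat.exists_eq_add_of_lt hij
    have := key d (l - m) (F^[j] x)
    rw [← Function.iterate_add_apply, show d + 1 + j = j + d + 1 by ring] at this
    push_cast at this ⊢
    rcases this with h | h <;> constructor <;> intro h' <;> linarith

/-- Disjoint subintervals of `(0, 2)` have total length at most `2`. -/
theorem sum_length_le_two {ι : Type*} (s : Finset ι) (a b : ι → ℝ) (hab : ∀ i ∈ s, a i ≤ b i)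
    (ha : ∀ i ∈ s, 0 ≤ a i) (hb : ∀ i ∈ s, b i ≤ 2)
    (hd : ∀ i ∈ s, ∀ j ∈ s, i ≠ j → b i ≤ a j ∨ b j ≤ a i) :
    ∑ i ∈ s, (b i - a i) ≤ 2 := by
  have hdisj : (s : Set ι).PairwiseDisjoint (fun i => Ioo (a i) (b i)) := by
    intro i hi j hj hij
    rw [Function.onFun, Set.disjoint_left]
    rintro x ⟨h1, h2⟩ ⟨h3, h4⟩
    rcases hd i hi j hj hij with h | h <;> linarith
  have hvol := MeasureTheory.measureReal_biUnion_finset (μ := MeasureTheory.volume) hdisj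
    (fun i _ => measurableSet_Ioo) (fun i _ => by simp)
  have hle : MeasureTheory.volume.real (⋃ i ∈ s, Ioo (a i) (b i)) ≤
      MeasureTheory.volume.real (Icc (0 : ℝ) 2) := by
    refine MeasureTheory.measureReal_mono ?_ (by simp)
    refine iUnion₂_subset fun i hi x hx => ?_
    exact ⟨(ha i hi).trans hx.1.le, hx.2.le.trans (hb i hi)⟩
  rw [hvol] at hle
  calc ∑ i ∈ s, (b i - a i) = ∑ i ∈ s, MeasureTheory.volume.real (Ioo (a i) (b i)) :=
        Finset.sum_congr rfl fun i hi => by rw [Real.volume_real_Ioo_of_le (hab i hi)]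
    _ ≤ _ := hle
    _ = 2 := by rw [Real.volume_real_Icc_of_le] <;> norm_num

/-- The lift `F ^ q n - p n` of the `n`-th closest return map. -/
def closestReturn (F : ℝ → ℝ) (q p : ℕ → ℕ) (n : ℕ) (x : ℝ) : ℝ := F^[q n] x - p n

section Combinatorics

variable {F : ℝ → ℝ} {ρ : ℝ} {q p : ℕ → ℕ}

theorem iterate_closestReturn (hFp : ∀ x, F (x + 1) = F x + 1) (n i : ℕ) (x : ℝ) :
    F^[i] (closestReturn F q p n x) = F^[i + q n] x - p n := by
  have := iterate_add_int hFp i (F^[q n] x) (-(p n : ℤ))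
  push_cast at this
  rw [closestReturn, sub_eq_add_neg, this, ← Function.iterate_add_apply, sub_eq_add_neg]

theorem closestReturn_iterate_add_int (hFp : ∀ x, F (x + 1) = F x + 1) (n i : ℕ) (x : ℝ)
    (m : ℤ) :
    closestReturn F q p n (F^[i] x + m) = F^[i] (closestReturn F q p n x) + m := by
  rw [iterate_closestReturn hFp, closestReturn, iterate_add_int hFp, ← Function.iterate_add_apply,
    Nat.add_comm]
  ring

theorem closestReturn_comm (hFp : ∀ x, F (x + 1) = F x + 1) (n m : ℕ) (x : ℝ) :
    closestReturn F q p n (closestReturn F q p m x) =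
      closestReturn F q p m (closestReturn F q p n x) := by
  have h := closestReturn_iterate_add_int (q := q) (p := p) hFp n (q m) x (-(p m : ℤ))
  push_cast at h
  rw [← sub_eq_add_neg, ← sub_eq_add_neg] at h
  exact h

theorem closestReturn_strictMono (hF : StrictMono F) (n : ℕ) :
    StrictMono (closestReturn F q p n) := fun x y h => by
  have := hF.iterate (q n) h
  simp only [closestReturn]
  linarith

theorem lt_closestReturn (hord : OrderedAsRotation F ρ) {n : ℕ} (h : 0 < q n * ρ - p n)
    (x : ℝ) : x < closestReturn F q p n x := by
  have := (hord.lt_iff 0 (q n) 0 (-(p n : ℤ)) x).2 (by push_cast; linarith)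
  push_cast at this
  simpa [closestReturn, sub_eq_add_neg] using this

theorem closestReturn_lt (hord : OrderedAsRotation F ρ) {n : ℕ} (h : q n * ρ - p n < 0)
    (x : ℝ) : closestReturn F q p n x < x := by
  have := (hord.lt_iff (q n) 0 (-(p n : ℤ)) 0 x).2 (by push_cast; linarith)
  push_cast at this
  simpa [closestReturn, sub_eq_add_neg] using this

theorem closestReturn_ne (hord : OrderedAsRotation F ρ) (hc : IsConvergents ρ q p) (n : ℕ)
    (x : ℝ) : closestReturn F q p n x ≠ x := by
  rcases hc.sign n with ⟨h, -⟩ | ⟨h, -⟩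
  · exact (lt_closestReturn hord h x).ne'
  · exact (closestReturn_lt hord h x).ne

/-- Iterating `n + 2` stays on the same side and is closer, with a whole step of the opposite
return map in between. -/
theorem closestReturn_add_two (hFp : ∀ x, F (x + 1) = F x + 1) (hord : OrderedAsRotation F ρ)
    (hc : IsConvergents ρ q p) (n : ℕ) (x : ℝ) :
    (closestReturn F q p (n + 1) x < x ∧ x < closestReturn F q p (n + 2) x ∧
      closestReturn F q p (n + 2) x ≤
        closestReturn F q p n (closestReturn F q p (n + 1) x)) ∨
    (x < closestReturn F q p (n + 1) x ∧ closestReturn F q p (n + 2) x < x ∧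
      closestReturn F q p n (closestReturn F q p (n + 1) x) ≤
        closestReturn F q p (n + 2) x) := by
  have hcomp : closestReturn F q p n (closestReturn F q p (n + 1) x) =
      F^[q (n + 1) + q n] x + (-(p (n + 1)) - p n : ℤ) := by
    conv_lhs => rw [closestReturn, iterate_closestReturn hFp, Nat.add_comm]
    push_cast
    ring
  rw [hcomp]
  rcases hc.sign n with ⟨h0, h1, h2, h3⟩ | ⟨h0, h1, h2, h3⟩
  · refine .inl ⟨closestReturn_lt hord h1 x, lt_closestReturn hord h2 x, ?_⟩
    have := (hord (q (n + 2)) (q (n + 1) + q n) (-(p (n + 2) : ℤ)) (-(p (n + 1)) - p n) x).2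
      (by push_cast; linarith)
    simpa [closestReturn, sub_eq_add_neg] using this
  · refine .inr ⟨lt_closestReturn hord h1 x, closestReturn_lt hord h2 x, ?_⟩
    have := (hord (q (n + 1) + q n) (q (n + 2)) (-(p (n + 1)) - p n) (-(p (n + 2) : ℤ)) x).2
      (by push_cast; linarith)
    simpa [closestReturn, sub_eq_add_neg] using this

theorem closestReturn_add_two_mem (hF : StrictMono F) (hFp : ∀ x, F (x + 1) = F x + 1)
    (hord : OrderedAsRotation F ρ) (hc : IsConvergents ρ q p) (n : ℕ) (x : ℝ) :
    closestReturn F q p (n + 2) x ∈ uIcc x (closestReturn F q p n x) := by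
  rw [mem_uIcc]
  rcases closestReturn_add_two hFp hord hc n x with ⟨h1, h2, h3⟩ | ⟨h1, h2, h3⟩
  · exact .inl ⟨h2.le, h3.trans (closestReturn_strictMono hF n h1).le⟩
  · exact .inr ⟨(closestReturn_strictMono hF n h1).le.trans h3, h2.le⟩

theorem abs_closestReturn_sub_le_one (hord : OrderedAsRotation F ρ) (hc : IsConvergents ρ q p)
    (n : ℕ) (x : ℝ) : |closestReturn F q p n x - x| ≤ 1 := by
  have h := abs_le.1 (hc.abs_le_one n)
  have h1 := (hord (q n) 0 (-(p n : ℤ)) 1 x).2 (by push_cast; linarith)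
  have h2 := (hord 0 (q n) (-1) (-(p n : ℤ)) x).2 (by push_cast; linarith)
  rw [abs_le, closestReturn]
  simp only [Function.iterate_zero, id] at h1 h2
  push_cast at h1 h2
  constructor <;> linarith

/-- The first `q (n + 1)` iterates of `[x, closestReturn n x]` are disjoint modulo `1`. -/
theorem sum_abs_iterate_sub_le (hF : StrictMono F) (hFp : ∀ x, F (x + 1) = F x + 1)
    (hord : OrderedAsRotation F ρ) (hc : IsConvergents ρ q p) (n : ℕ) {x a b : ℝ}
    (ha : a ∈ uIcc x (closestReturn F q p n x)) (hb : b ∈ uIcc x (closestReturn F q p n x)) :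
    ∑ i ∈ Finset.range (q (n + 1)), |F^[i] a - F^[i] b| ≤ 2 := by
  set y := closestReturn F q p n x with hy
  have hle : ∀ i, |F^[i] a - F^[i] b| ≤ max (F^[i] x) (F^[i] y) - min (F^[i] x) (F^[i] y) := by
    intro i
    have hm := (hF.iterate i).monotone
    have hmem : ∀ c ∈ uIcc x y,
        min (F^[i] x) (F^[i] y) ≤ F^[i] c ∧ F^[i] c ≤ max (F^[i] x) (F^[i] y) := by
      intro c hc
      rw [← hm.map_min, ← hm.map_max]
      exact ⟨hm hc.1, hm hc.2⟩
    have h1 := hmem a ha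
    have h2 := hmem b hb
    rw [abs_le]
    constructor <;> linarith
  have hlen : ∀ i, max (F^[i] x) (F^[i] y) - min (F^[i] x) (F^[i] y) ≤ 1 := by
    intro i
    have h := abs_closestReturn_sub_le_one hord hc n (F^[i] x)
    have h' := closestReturn_iterate_add_int (q := q) (p := p) hFp n i x 0
    simp only [Int.cast_zero, add_zero] at h'
    rw [h', ← hy] at h
    rwa [max_sub_min_eq_abs]
  refine (Finset.sum_le_sum fun i _ => hle i).trans ?_
  have := sum_length_le_two (Finset.range (q (n + 1)))
    (fun i => min (F^[i] x) (F^[i] y) - ⌊min (F^[i] x) (F^[i] y)⌋)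
    (fun i => max (F^[i] x) (F^[i] y) - ⌊min (F^[i] x) (F^[i] y)⌋)
    (fun i _ => by have := min_le_max (a := F^[i] x) (b := F^[i] y); linarith)
    (fun i _ => by have := Int.floor_le (min (F^[i] x) (F^[i] y)); linarith)
    (fun i _ => by
      have h1 := Int.lt_floor_add_one (min (F^[i] x) (F^[i] y))
      have h2 := hlen i
      linarith) ?_
  · simpa only [sub_sub_sub_cancel_right] using this
  intro i hi j hj hij
  wlog hlt : i < j generalizing i j
  · exact (this j hj i hi hij.symm (by omega)).symm
  generalize ⌊min (F^[i] x) (F^[i] y)⌋ = u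
  generalize ⌊min (F^[j] x) (F^[j] y)⌋ = v
  have hFy : ∀ i, F^[i] y = F^[i + q n] x - p n := fun i => iterate_closestReturn hFp n i x
  have hbest := hc.best n (j - i) (v - u) (by omega)
    (by have := Finset.mem_range.1 hj; omega)
  push_cast at hbest
  rcases hc.sign n with ⟨h0, -⟩ | ⟨h0, -⟩
  · have hmin : ∀ i, F^[i] x ≤ F^[i] y := fun i =>
      (hF.iterate i).monotone (lt_closestReturn hord h0 x).le
    rw [min_eq_left (hmin i), min_eq_left (hmin j), max_eq_right (hmin i), max_eq_right (hmin j),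
      hFy, hFy]
    rw [abs_of_pos h0, le_abs'] at hbest
    rcases hbest with h | h
    · right
      have := (hord (j + q n) i (-(p n : ℤ) - v) (-u) x).2 (by push_cast; linarith)
      push_cast at this
      linarith
    · left
      have := (hord (i + q n) j (-(p n : ℤ) - u) (-v) x).2 (by push_cast; linarith)
      push_cast at this
      linarith
  · have hmin : ∀ i, F^[i] y ≤ F^[i] x := fun i =>
      (hF.iterate i).monotone (closestReturn_lt hord h0 x).le
    rw [min_eq_right (hmin i), min_eq_right (hmin j), max_eq_left (hmin i), max_eq_left (hmin j),
      hFy, hFy]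
    rw [abs_of_neg h0, le_abs'] at hbest
    rcases hbest with h | h
    · right
      have := (hord j (i + q n) (-v) (-(p n : ℤ) - u) x).2 (by push_cast; linarith)
      push_cast at this
      linarith
    · left
      have := (hord i (j + q n) (-u) (-(p n : ℤ) - v) x).2 (by push_cast; linarith)
      push_cast at this
      linarith

/-- The intervals `[F ^ j z, closestReturn n (F ^ j z)]` with `j < q (n + 1) + q n` cover the
circle. -/
theorem exists_mem_uIcc_closestReturn (hFp : ∀ x, F (x + 1) = F x + 1)
    (hord : OrderedAsRotation F ρ) (hc : IsConvergents ρ q p) (n : ℕ) (x z : ℝ) :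
    ∃ j < q (n + 1) + q n, ∃ m : ℤ,
      x ∈ uIcc (F^[j] z + m) (closestReturn F q p n (F^[j] z + m)) := by
  have hG : ∀ (j : ℕ) (m : ℤ), closestReturn F q p n (F^[j] z + m) =
      F^[j + q n] z + ((m - p n : ℤ) : ℝ) := by
    intro j m
    rw [closestReturn_iterate_add_int hFp, iterate_closestReturn hFp]
    push_cast
    ring
  have hpos : 0 < q (n + 1) + q n := Nat.add_pos_left (hc.pos _) _
  have hne : (Finset.range (q (n + 1) + q n)).Nonempty := ⟨0, Finset.mem_range.2 hpos⟩
  rcases hc.sign n with ⟨h0, h1, h2, h3⟩ | ⟨h0, h1, h2, h3⟩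
  · obtain ⟨j, hj, hmax⟩ := Finset.exists_max_image _
      (fun j => F^[j] z + ⌊x - F^[j] z⌋) hne
    have hlast : ∀ i < q (n + 1) + q n, ∀ l : ℤ,
        F^[j] z + ⌊x - F^[j] z⌋ < F^[i] z + l → x < F^[i] z + l := by
      intro i hi l h
      by_contra! hcon
      have h4 : l ≤ ⌊x - F^[i] z⌋ := Int.le_floor.2 (by linarith)
      have h5 := hmax i (Finset.mem_range.2 hi)
      have h6 : (l : ℝ) ≤ ⌊x - F^[i] z⌋ := by exact_mod_cast h4
      linarith
    have hle : F^[j] z + ⌊x - F^[j] z⌋ ≤ x := by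
      have := Int.floor_le (x - F^[j] z); linarith
    have hj' := Finset.mem_range.1 hj
    refine ⟨j, hj', ⌊x - F^[j] z⌋, ?_⟩
    generalize ⌊x - F^[j] z⌋ = m at *
    rw [mem_uIcc, hG]
    refine .inl ⟨hle, ?_⟩
    rcases lt_or_ge j (q (n + 1)) with hjq | hjq
    · refine (hlast (j + q n) (by omega) _ ((hord.lt_iff _ _ _ _ _).2 ?_)).le
      push_cast
      linarith
    · obtain ⟨i, rfl⟩ := Nat.exists_eq_add_of_le hjq
      refine (hlast i (by omega) (m + p (n + 1)) ((hord.lt_iff _ _ _ _ _).2 ?_)).le.trans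
        ((hord _ _ _ _ _).2 ?_)
      · push_cast
        linarith
      · push_cast
        linarith
  · obtain ⟨j, hj, hmin⟩ := Finset.exists_min_image _
      (fun j => F^[j] z + ⌈x - F^[j] z⌉) hne
    have hlast : ∀ i < q (n + 1) + q n, ∀ l : ℤ,
        F^[i] z + l < F^[j] z + ⌈x - F^[j] z⌉ → F^[i] z + l < x := by
      intro i hi l h
      by_contra! hcon
      have h4 : ⌈x - F^[i] z⌉ ≤ l := Int.ceil_le.2 (by linarith)
      have h5 := hmin i (Finset.mem_range.2 hi)
      have h6 : (⌈x - F^[i] z⌉ : ℝ) ≤ l := by exact_mod_cast h4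
      linarith
    have hle : x ≤ F^[j] z + ⌈x - F^[j] z⌉ := by
      have := Int.le_ceil (x - F^[j] z); linarith
    have hj' := Finset.mem_range.1 hj
    refine ⟨j, hj', ⌈x - F^[j] z⌉, ?_⟩
    generalize ⌈x - F^[j] z⌉ = m at *
    rw [mem_uIcc, hG]
    refine .inr ⟨?_, hle⟩
    rcases lt_or_ge j (q (n + 1)) with hjq | hjq
    · refine (hlast (j + q n) (by omega) _ ((hord.lt_iff _ _ _ _ _).2 ?_)).le
      push_cast
      linarith
    · obtain ⟨i, rfl⟩ := Nat.exists_eq_add_of_le hjq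
      refine le_trans ((hord _ _ _ _ _).2 ?_)
        (hlast i (by omega) (m + p (n + 1)) ((hord.lt_iff _ _ _ _ _).2 ?_)).le
      · push_cast
        linarith
      · push_cast
        linarith

end Combinatorics

theorem exists_sub_eq_deriv_mul {f f' : ℝ → ℝ} (hf : ∀ x, HasDerivAt f (f' x) x) (a b : ℝ) :
    ∃ ξ ∈ uIcc a b, f b - f a = f' ξ * (b - a) := by
  have key : ∀ a b : ℝ, a < b → ∃ ξ ∈ uIcc a b, f b - f a = f' ξ * (b - a) := by
    intro a b hab
    obtain ⟨ξ, hξ, h⟩ := exists_hasDerivAt_eq_slope f f' hab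
      (fun x _ => (hf x).continuousAt.continuousWithinAt) (fun x _ => hf x)
    refine ⟨ξ, Icc_subset_uIcc (Ioo_subset_Icc_self hξ), ?_⟩
    rw [h, div_mul_cancel₀ _ (sub_ne_zero.2 hab.ne')]
  rcases lt_trichotomy a b with h | rfl | h
  · exact key a b h
  · exact ⟨a, left_mem_uIcc, by simp⟩
  · obtain ⟨ξ, hξ, h'⟩ := key b a h
    exact ⟨ξ, uIcc_comm b a ▸ hξ, by linarith⟩

theorem hasDerivAt_periodic {f f' : ℝ → ℝ} {c : ℝ} (hf : ∀ x, HasDerivAt f (f' x) x)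
    (hp : ∀ x, f (x + 1) = f x + c) (x : ℝ) : f' (x + 1) = f' x := by
  have h1 : HasDerivAt (fun y => f (y + 1)) (f' (x + 1)) x := (hf (x + 1)).comp_add_const x 1
  have h2 : HasDerivAt (fun y => f (y + 1)) (f' x) x := by
    simp only [hp]
    exact (hf x).add_const c
  exact h1.unique h2

theorem exists_abs_le_of_periodic {f : ℝ → ℝ} (hf : Continuous f) (hp : ∀ x, f (x + 1) = f x) :
    ∃ B, 0 < B ∧ ∀ x, |f x| ≤ B := by
  obtain ⟨B, hB⟩ := (isCompact_Icc (a := (0 : ℝ)) (b := 1)).exists_bound_of_continuousOn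
    hf.continuousOn
  refine ⟨|B| + 1, by positivity, fun x => ?_⟩
  obtain ⟨y, hy, h⟩ := Function.Periodic.exists_mem_Ico₀ (f := f) hp one_pos x
  rw [h]
  exact (hB y (Ico_subset_Icc_self hy)).trans ((le_abs_self B).trans (by linarith))

theorem IsModulus.mono {w : ℝ → ℝ} (hw : IsModulus w) {x y : ℝ} (hx : 0 < x) (hxy : x ≤ y) :
    w x ≤ w y :=
  hw.strictMono.monotoneOn hx (hx.trans_le hxy) hxy

theorem IsModulus.le_nat_mul {w : ℝ → ℝ} (hw : IsModulus w) {x : ℝ} (hx : 0 < x) (n : ℕ) :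
    w ((n + 1 : ℕ) * x) ≤ (n + 1 : ℕ) * w x := by
  induction n with
  | zero => simp
  | succ n ih =>
    have h := hw.subadd ((n + 1 : ℕ) * x) x (by positivity) hx
    calc w ((n + 1 + 1 : ℕ) * x) = w ((n + 1 : ℕ) * x + x) := by push_cast; ring_nf
      _ ≤ _ := h
      _ ≤ (n + 1 : ℕ) * w x + w x := by linarith
      _ = _ := by push_cast; ring

theorem IsModulus.mul_le {w : ℝ → ℝ} (hw : IsModulus w) {x : ℝ} (hx : 0 < x) (hx1 : x ≤ 1) :
    x * w 1 ≤ 2 * w x := by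
  have h1 : 1 ≤ (⌊1 / x⌋₊ + 1 : ℕ) * x := by
    have := Nat.lt_floor_add_one (1 / x)
    rw [div_lt_iff₀ hx] at this
    push_cast
    exact this.le
  have h2 : (⌊1 / x⌋₊ + 1 : ℕ) * x ≤ 2 := by
    have := Nat.floor_le (a := 1 / x) (by positivity)
    rw [le_div_iff₀ hx] at this
    push_cast
    linarith
  have h3 := (hw.mono one_pos h1).trans (hw.le_nat_mul hx ⌊1 / x⌋₊)
  have h4 := hw.pos x hx
  calc x * w 1 ≤ x * ((⌊1 / x⌋₊ + 1 : ℕ) * w x) := by gcongr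
    _ = ((⌊1 / x⌋₊ + 1 : ℕ) * x) * w x := by ring
    _ ≤ 2 * w x := by gcongr

theorem IsModulus.continuous_of_forall {w f : ℝ → ℝ} (hw : IsModulus w)
    (hf : ∀ x y : ℝ, x ≠ y → |f x - f y| ≤ w |x - y|) : Continuous f := by
  rw [Metric.continuous_iff]
  intro b ε hε
  obtain ⟨δ, hδ, h⟩ := Metric.tendsto_nhdsWithin_nhds.1 hw.tendsto ε hε
  refine ⟨δ, hδ, fun a hab => ?_⟩
  rcases eq_or_ne a b with rfl | hne
  · simpa using hε
  · have hpos : 0 < |a - b| := abs_pos.2 (sub_ne_zero.2 hne)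
    have := h (x := |a - b|) hpos (by simpa [Real.dist_eq] using hab)
    rw [Real.dist_eq, sub_zero, abs_of_pos (hw.pos _ hpos)] at this
    rw [Real.dist_eq]
    exact (hf a b hne).trans_lt this

/-- The defect of `F` from being a Möbius map on `[a, b]`, measured by comparing the slope with the
geometric mean of the derivatives `exp (φ a)` and `exp (φ b)` at the endpoints, is
`O(|b - a| * w |b - a|)`. -/
def AlmostMoebius (F φ w : ℝ → ℝ) (C : ℝ) : Prop :=
  ∀ Λ a b : ℝ, 0 < Λ → Λ ≤ 1 → |b - a| ≤ Λ →
    ∃ ε, |ε| ≤ C * w Λ * |b - a| ∧ F b - F a = (b - a) * Real.exp ((φ a + φ b) / 2 + ε)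

theorem abs_sub_trapezoid_le {w F F' F'' : ℝ → ℝ} (hw : IsModulus w)
    (hF' : ∀ x, HasDerivAt F (F' x) x) (hF'' : ∀ x, HasDerivAt F' (F'' x) x)
    (hmod : ∀ x y : ℝ, x ≠ y → |F'' x - F'' y| ≤ w |x - y|) {Λ a b : ℝ} (hΛ : 0 < Λ)
    (hab : |b - a| ≤ Λ) :
    |F b - F a - (b - a) * ((F' a + F' b) / 2)| ≤ w Λ / 2 * |b - a| * |b - a| := by
  have hder : ∀ t, HasDerivAt (fun t => F t - F a - (t - a) * ((F' a + F' t) / 2))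
      ((F' t - F' a - (t - a) * F'' t) / 2) t := by
    intro t
    have h1 := ((hF' t).sub_const (F a)).sub
      (((hasDerivAt_id t).sub_const a).mul (((hF'' t).const_add (F' a)).div_const 2))
    refine h1.congr_deriv ?_
    simp only [id]
    ring
  have hbound : ∀ t ∈ uIcc a b, ‖(F' t - F' a - (t - a) * F'' t) / 2‖ ≤ w Λ / 2 * |b - a| := by
    intro t ht
    obtain ⟨ξ, hξ, h⟩ := exists_sub_eq_deriv_mul hF'' a t
    have hta : |t - a| ≤ |b - a| := abs_sub_left_of_mem_uIcc ht
    have hξt : |F'' ξ - F'' t| ≤ w Λ := by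
      rcases eq_or_ne ξ t with rfl | hne
      · simpa using (hw.pos Λ hΛ).le
      · refine (hmod ξ t hne).trans (hw.mono (abs_pos.2 (sub_ne_zero.2 hne)) ?_)
        have := abs_sub_right_of_mem_uIcc hξ
        rw [abs_sub_comm]
        linarith
    have hwΛ := hw.pos Λ hΛ
    rw [Real.norm_eq_abs, h, show (F'' ξ * (t - a) - (t - a) * F'' t) / 2 =
      (F'' ξ - F'' t) * (t - a) / 2 by ring, abs_div, abs_mul, abs_two]
    have := mul_le_mul hξt hta (abs_nonneg _) hwΛ.le
    linarith
  have := (convex_uIcc a b).norm_image_sub_le_of_norm_hasDerivWithin_le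
    (fun t _ => (hder t).hasDerivWithinAt) hbound left_mem_uIcc right_mem_uIcc
  simpa only [sub_self, zero_mul, sub_zero, Real.norm_eq_abs] using this

theorem abs_log_le_of_le {z c : ℝ} (hc : 0 < c) (hc1 : c ≤ 1) (hz : c ≤ z) :
    |Real.log z| ≤ |z - 1| / c := by
  have hz0 := hc.trans_le hz
  have h1 : |z - 1| ≤ |z - 1| / c := le_div_self (abs_nonneg _) hc hc1
  rw [abs_le]
  constructor
  · have h2 := Real.log_le_sub_one_of_pos (inv_pos.2 hz0)
    rw [Real.log_inv] at h2
    have h3 : z⁻¹ - 1 ≤ |z - 1| / c := by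
      calc z⁻¹ - 1 = (1 - z) / z := by field_simp
        _ ≤ |z - 1| / z := by gcongr; rw [abs_sub_comm]; exact le_abs_self _
        _ ≤ |z - 1| / c := by gcongr
    linarith
  · exact (Real.log_le_sub_one_of_pos hz0).trans ((le_abs_self _).trans h1)

theorem almostMoebius_of_modulus {w F F' F'' φ : ℝ → ℝ} {B M : ℝ} (hw : IsModulus w)
    (hF' : ∀ x, HasDerivAt F (F' x) x) (hF'' : ∀ x, HasDerivAt F' (F'' x) x)
    (hmod : ∀ x y : ℝ, x ≠ y → |F'' x - F'' y| ≤ w |x - y|)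
    (hφ : ∀ x, F' x = Real.exp (φ x)) (hB : ∀ x, |φ x| ≤ B)
    (hM : ∀ x y, |φ x - φ y| ≤ M * |x - y|) :
    ∃ C, 0 ≤ C ∧ AlmostMoebius F φ w C := by
  have hB0 : 0 ≤ B := (abs_nonneg _).trans (hB 0)
  have hw1 := hw.pos 1 one_pos
  set C₁ := Real.exp B / 2 + M ^ 2 * Real.exp (M ^ 2 / 8) / (4 * w 1) with hC₁
  refine ⟨C₁ / Real.exp (-(2 * B)), by positivity, fun Λ a b hΛ hΛ1 hab => ?_⟩
  rcases eq_or_ne a b with rfl | hne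
  · exact ⟨0, by simp, by simp⟩
  have hba : b - a ≠ 0 := sub_ne_zero.2 hne.symm
  have hwΛ := hw.pos Λ hΛ
  set m := (φ a + φ b) / 2 with hm
  have hBa := abs_le.1 (hB a)
  have hBb := abs_le.1 (hB b)
  set Z := (F b - F a) / ((b - a) * Real.exp m) with hZ
  have hFZ : F b - F a = (b - a) * Real.exp m * Z := by
    rw [hZ]; field_simp
  have hZlow : Real.exp (-(2 * B)) ≤ Z := by
    obtain ⟨ξ, -, h⟩ := exists_sub_eq_deriv_mul hF' a b
    have : Z = Real.exp (φ ξ - m) := by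
      rw [hZ, h, hφ, Real.exp_sub]
      field_simp
    rw [this, Real.exp_le_exp]
    have := abs_le.1 (hB ξ)
    linarith
  have hcosh : (F' a + F' b) / 2 = Real.exp m * Real.cosh ((φ a - φ b) / 2) := by
    rw [Real.cosh_eq, hφ, hφ, mul_div_assoc', mul_add, ← Real.exp_add, ← Real.exp_add]
    congr 3 <;> simp only [hm] <;> ring
  have h1 : |Z - Real.cosh ((φ a - φ b) / 2)| ≤ w Λ / 2 * |b - a| * Real.exp B := by
    have h := abs_sub_trapezoid_le hw hF' hF'' hmod hΛ hab
    rw [hFZ, hcosh, show (b - a) * Real.exp m * Z -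
      (b - a) * (Real.exp m * Real.cosh ((φ a - φ b) / 2)) =
      (b - a) * Real.exp m * (Z - Real.cosh ((φ a - φ b) / 2)) by ring, abs_mul, abs_mul,
      abs_of_pos (Real.exp_pos m), mul_assoc, mul_comm |b - a|] at h
    have h' := le_of_mul_le_mul_right h (abs_pos.2 hba)
    calc |Z - Real.cosh ((φ a - φ b) / 2)|
        = Real.exp (-m) * (Real.exp m * |Z - Real.cosh ((φ a - φ b) / 2)|) := by
          rw [← mul_assoc, ← Real.exp_add, neg_add_cancel, Real.exp_zero, one_mul]
      _ ≤ Real.exp B * (w Λ / 2 * |b - a|) := by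
          gcongr
          linarith
      _ = _ := by ring
  have h2 : |Real.cosh ((φ a - φ b) / 2) - 1| ≤
      M ^ 2 * Real.exp (M ^ 2 / 8) / (4 * w 1) * w Λ * |b - a| := by
    rw [abs_of_nonneg (sub_nonneg.2 (Real.one_le_cosh _))]
    set y := ((φ a - φ b) / 2) ^ 2 / 2 with hy
    have hd : (φ a - φ b) ^ 2 ≤ M ^ 2 * |b - a| ^ 2 := by
      rw [← sq_abs, ← mul_pow, abs_sub_comm b a]
      exact pow_le_pow_left₀ (abs_nonneg _) (hM a b) 2
    have hba1 : |b - a| ^ 2 ≤ 1 := pow_le_one₀ (abs_nonneg _) (hab.trans hΛ1)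
    have hy1 : y ≤ M ^ 2 / 8 * |b - a| ^ 2 := by rw [hy]; linarith
    have hy2 : y ≤ M ^ 2 / 8 := hy1.trans (by nlinarith [sq_nonneg M])
    have hsq : |b - a| ^ 2 ≤ 2 * w Λ / w 1 * |b - a| := by
      rw [sq]
      gcongr
      rw [le_div_iff₀ hw1]
      exact (mul_le_mul_of_nonneg_right hab hw1.le).trans (hw.mul_le hΛ hΛ1)
    have hexp : Real.exp y - 1 ≤ y * Real.exp y := by
      have := Real.add_one_le_exp (-y)
      have h3 := mul_le_mul_of_nonneg_right this (Real.exp_pos y).le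
      rw [← Real.exp_add, neg_add_cancel, Real.exp_zero] at h3
      linarith
    have hy0 : 0 ≤ y := by positivity
    calc Real.cosh ((φ a - φ b) / 2) - 1 ≤ Real.exp y - 1 := by
          gcongr; exact Real.cosh_le_exp_half_sq _
      _ ≤ y * Real.exp y := hexp
      _ ≤ (M ^ 2 / 8 * (2 * w Λ / w 1 * |b - a|)) * Real.exp (M ^ 2 / 8) := by
          gcongr
          exact hy1.trans (by gcongr)
      _ = _ := by field_simp; ring
  have h3 : |Z - 1| ≤ C₁ * w Λ * |b - a| := by
    calc |Z - 1| ≤ |Z - Real.cosh ((φ a - φ b) / 2)| + |Real.cosh ((φ a - φ b) / 2) - 1| :=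
          abs_sub_le _ _ _
      _ ≤ _ := add_le_add h1 h2
      _ = _ := by rw [hC₁]; ring
  refine ⟨Real.log Z, ?_, ?_⟩
  · calc |Real.log Z| ≤ |Z - 1| / Real.exp (-(2 * B)) :=
          abs_log_le_of_le (Real.exp_pos _) (Real.exp_le_one_iff.2 (by linarith)) hZlow
      _ ≤ C₁ * w Λ * |b - a| / Real.exp (-(2 * B)) := by gcongr
      _ = _ := by ring
  · rw [Real.exp_add, Real.exp_log ((Real.exp_pos _).trans_le hZlow), hFZ, mul_assoc]

theorem hasDerivAt_iterate_exp_birkhoffSum {F φ : ℝ → ℝ}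
    (hF : ∀ x, HasDerivAt F (Real.exp (φ x)) x) (n : ℕ) (x : ℝ) :
    HasDerivAt F^[n] (Real.exp (birkhoffSum F φ n x)) x := by
  induction n with
  | zero => simpa using hasDerivAt_id x
  | succ n ih =>
    rw [Function.iterate_succ', birkhoffSum_succ, add_comm, Real.exp_add]
    exact (hF _).comp x ih

theorem AlmostMoebius.iterate {F φ w : ℝ → ℝ} {C : ℝ} (h : AlmostMoebius F φ w C) {Λ : ℝ}
    (hΛ : 0 < Λ) (hΛ1 : Λ ≤ 1) (n : ℕ) {a b : ℝ} (hab : ∀ i < n, |F^[i] a - F^[i] b| ≤ Λ) :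
    ∃ ε, |ε| ≤ C * w Λ * ∑ i ∈ Finset.range n, |F^[i] a - F^[i] b| ∧
      F^[n] b - F^[n] a =
        (b - a) * Real.exp ((birkhoffSum F φ n a + birkhoffSum F φ n b) / 2 + ε) := by
  induction n with
  | zero => exact ⟨0, by simp, by simp⟩
  | succ n ih =>
    obtain ⟨ε₁, h₁, h₁'⟩ := ih fun i hi => hab i (hi.trans n.lt_succ_self)
    obtain ⟨ε₂, h₂, h₂'⟩ := h Λ (F^[n] a) (F^[n] b) hΛ hΛ1
      (by rw [abs_sub_comm]; exact hab n n.lt_succ_self)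
    refine ⟨ε₁ + ε₂, ?_, ?_⟩
    · rw [Finset.sum_range_succ, mul_add, abs_sub_comm (F^[n] a)]
      exact (abs_add_le _ _).trans (add_le_add h₁ h₂)
    · rw [Function.iterate_succ_apply', Function.iterate_succ_apply', h₂', h₁', mul_assoc,
        ← Real.exp_add, birkhoffSum_succ, birkhoffSum_succ]
      ring_nf

/-- A circle diffeomorphism, given by a lift `F` with derivative `exp ∘ φ`, whose rotation number
`ρ` has convergents `p n / q n`, and for which `φ` is Lipschitz. -/
structure IsDenjoyLift (F φ : ℝ → ℝ) (ρ : ℝ) (q p : ℕ → ℕ) (M : ℝ) : Prop where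
  strictMono : StrictMono F
  map_add_one : ∀ x, F (x + 1) = F x + 1
  ordered : OrderedAsRotation F ρ
  convergents : IsConvergents ρ q p
  hasDerivAt : ∀ x, HasDerivAt F (Real.exp (φ x)) x
  periodic : ∀ x, φ (x + 1) = φ x
  lipschitz : ∀ x y, |φ x - φ y| ≤ M * |x - y|

namespace IsDenjoyLift

variable {F φ : ℝ → ℝ} {ρ M : ℝ} {q p : ℕ → ℕ}

theorem nonneg (h : IsDenjoyLift F φ ρ q p M) : 0 ≤ M := by
  have := (abs_nonneg _).trans (h.lipschitz 1 0)
  simpa using this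

theorem continuous_birkhoffSum (h : IsDenjoyLift F φ ρ q p M) (n : ℕ) :
    Continuous (birkhoffSum F φ n) := by
  have hφ : Continuous φ := by
    have : LipschitzWith ⟨M, h.nonneg⟩ φ := LipschitzWith.of_dist_le_mul fun x y => by
      rw [Real.dist_eq, Real.dist_eq]
      exact h.lipschitz x y
    exact this.continuous
  have hF : Continuous F := continuous_iff_continuousAt.2 fun x => (h.hasDerivAt x).continuousAt
  exact continuous_finsetSum _ fun i _ => hφ.comp (hF.iterate i)

theorem birkhoffSum_add_int (h : IsDenjoyLift F φ ρ q p M) (n : ℕ) (x : ℝ) (m : ℤ) :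
    birkhoffSum F φ n (x + m) = birkhoffSum F φ n x := by
  refine Finset.sum_congr rfl fun i _ => ?_
  rw [iterate_add_int h.map_add_one]
  have := Function.Periodic.int_mul (f := φ) h.periodic m (F^[i] x)
  simpa using this

theorem abs_birkhoffSum_sub_le (h : IsDenjoyLift F φ ρ q p M) (n : ℕ) (a b : ℝ) :
    |birkhoffSum F φ n a - birkhoffSum F φ n b| ≤
      M * ∑ i ∈ Finset.range n, |F^[i] a - F^[i] b| := by
  rw [birkhoffSum, birkhoffSum, ← Finset.sum_sub_distrib, Finset.mul_sum]
  exact (Finset.abs_sum_le_sum_abs _ _).trans (Finset.sum_le_sum fun i _ => h.lipschitz _ _)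

theorem distortion (h : IsDenjoyLift F φ ρ q p M) {n j : ℕ} (hj : j ≤ q (n + 1)) {x a b : ℝ}
    (ha : a ∈ uIcc x (closestReturn F q p n x)) (hb : b ∈ uIcc x (closestReturn F q p n x)) :
    |birkhoffSum F φ j a - birkhoffSum F φ j b| ≤ 2 * M := by
  refine (h.abs_birkhoffSum_sub_le j a b).trans ?_
  have h1 := sum_abs_iterate_sub_le h.strictMono h.map_add_one h.ordered h.convergents n ha hb
  have h2 : ∑ i ∈ Finset.range j, |F^[i] a - F^[i] b| ≤
      ∑ i ∈ Finset.range (q (n + 1)), |F^[i] a - F^[i] b| :=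
    Finset.sum_le_sum_of_subset_of_nonneg (Finset.range_mono hj) fun _ _ _ => abs_nonneg _
  have := h.nonneg
  nlinarith

theorem birkhoffSum_iterate_sub (h : IsDenjoyLift F φ ρ q p M) (n j : ℕ) (x : ℝ) :
    birkhoffSum F φ (q n) (F^[j] x) - birkhoffSum F φ (q n) x =
      birkhoffSum F φ j (closestReturn F q p n x) - birkhoffSum F φ j x := by
  have h1 := birkhoffSum_add F φ j (q n) x
  have h2 := birkhoffSum_add F φ (q n) j x
  have h3 := h.birkhoffSum_add_int j (closestReturn F q p n x) (p n)
  simp only [closestReturn, Int.cast_natCast, sub_add_cancel] at h3 ⊢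
  rw [Nat.add_comm] at h2
  linarith

theorem birkhoffSum_closestReturn_sub (h : IsDenjoyLift F φ ρ q p M) (n m : ℕ) (x : ℝ) :
    birkhoffSum F φ (q n) (closestReturn F q p m x) - birkhoffSum F φ (q n) x =
      birkhoffSum F φ (q m) (closestReturn F q p n x) - birkhoffSum F φ (q m) x := by
  rw [← h.birkhoffSum_iterate_sub n (q m) x,
    ← h.birkhoffSum_add_int (q n) (closestReturn F q p m x) (p m)]
  simp only [closestReturn, Int.cast_natCast, sub_add_cancel]

theorem exists_birkhoffSum_eq_zero (h : IsDenjoyLift F φ ρ q p M) (n : ℕ) :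
    ∃ z, birkhoffSum F φ n z = 0 := by
  obtain ⟨ξ, -, hξ⟩ :=
    exists_sub_eq_deriv_mul (hasDerivAt_iterate_exp_birkhoffSum h.hasDerivAt n) 0 1
  have := iterate_add_int h.map_add_one n 0 1
  simp only [zero_add, Int.cast_one] at this
  rw [this] at hξ
  refine ⟨ξ, Real.exp_eq_one_iff _ |>.1 ?_⟩
  linarith

/-- The Denjoy inequality. -/
theorem abs_birkhoffSum_succ_le (h : IsDenjoyLift F φ ρ q p M) (n : ℕ) (x : ℝ) :
    |birkhoffSum F φ (q (n + 1)) x| ≤ 4 * M := by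
  obtain ⟨z, hz⟩ := h.exists_birkhoffSum_eq_zero (q (n + 1))
  obtain ⟨j, hj, m, hx⟩ :=
    exists_mem_uIcc_closestReturn h.map_add_one h.ordered h.convergents n x z
  have h1 := h.distortion le_rfl hx left_mem_uIcc
  have h2 := h.distortion (n := n + 1) (hj.le.trans (h.convergents.add_le n))
    (right_mem_uIcc (a := z)) left_mem_uIcc
  rw [← h.birkhoffSum_iterate_sub, hz] at h2
  rw [h.birkhoffSum_add_int] at h1
  rw [abs_le] at *
  constructor <;> linarith

theorem exists_abs_birkhoffSum_le (h : IsDenjoyLift F φ ρ q p M) :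
    ∃ B, 0 < B ∧ ∀ n x, |birkhoffSum F φ (q n) x| ≤ B := by
  obtain ⟨B, hB, hB'⟩ := exists_abs_le_of_periodic (h.continuous_birkhoffSum (q 0))
    (fun x => by simpa using h.birkhoffSum_add_int (q 0) x 1)
  refine ⟨max B (4 * M), lt_max_of_lt_left hB, ?_⟩
  rintro (_ | n) x
  · exact (hB' x).trans (le_max_left _ _)
  · exact (h.abs_birkhoffSum_succ_le n x).trans (le_max_right _ _)

theorem hasDerivAt_closestReturn (h : IsDenjoyLift F φ ρ q p M) (n : ℕ) (x : ℝ) :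
    HasDerivAt (closestReturn F q p n) (Real.exp (birkhoffSum F φ (q n) x)) x :=
  (hasDerivAt_iterate_exp_birkhoffSum h.hasDerivAt (q n) x).sub_const _

theorem closestReturn_ratio_bounds (h : IsDenjoyLift F φ ρ q p M) {B : ℝ}
    (hB : ∀ n x, |birkhoffSum F φ (q n) x| ≤ B) (n : ℕ) (a b : ℝ) :
    Real.exp (-B) * |a - b| ≤ |closestReturn F q p n a - closestReturn F q p n b| ∧
      |closestReturn F q p n a - closestReturn F q p n b| ≤ Real.exp B * |a - b| := by
  obtain ⟨ξ, -, hξ⟩ := exists_sub_eq_deriv_mul (h.hasDerivAt_closestReturn n) b a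
  rw [hξ, abs_mul, Real.abs_exp]
  have := abs_le.1 (hB n ξ)
  constructor <;> gcongr <;> linarith

/-- Two steps of the renormalization contract the return distance by a definite factor. -/
theorem closestReturn_add_two_sub (h : IsDenjoyLift F φ ρ q p M) {B : ℝ}
    (hB : ∀ n x, |birkhoffSum F φ (q n) x| ≤ B) (n : ℕ) (x : ℝ) :
    ∃ θ, 0 ≤ θ ∧ θ ≤ 1 / (1 + Real.exp (-B) * Real.exp (-B)) ∧
      closestReturn F q p (n + 2) x - x = θ * (closestReturn F q p n x - x) := by
  have h4 := closestReturn_add_two h.map_add_one h.ordered h.convergents n x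
  have h5 := closestReturn_add_two h.map_add_one h.ordered h.convergents (n + 1) x
  rw [closestReturn_comm h.map_add_one (n + 1)] at h5
  set y := closestReturn F q p (n + 1) x
  have h6 := closestReturn_strictMono (q := q) (p := p) h.strictMono n
  have h7 := closestReturn_strictMono (q := q) (p := p) h.strictMono (n + 2)
  have h1 := (h.closestReturn_ratio_bounds hB n x y).1
  have h2 := (h.closestReturn_ratio_bounds hB (n + 2) x y).2
  have hne : closestReturn F q p n x - x ≠ 0 :=
    sub_ne_zero.2 (closestReturn_ne h.ordered h.convergents n x)
  have hE := Real.exp_pos (-B)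
  have hEB : Real.exp (-B) * Real.exp B = 1 := by
    rw [← Real.exp_add, neg_add_cancel, Real.exp_zero]
  have key : ∀ d e f : ℝ, Real.exp (-B) * d ≤ f → e ≤ Real.exp B * d →
      (1 + Real.exp (-B) * Real.exp (-B)) * e ≤ e + f := by
    intro d e f hf he
    have h8 := mul_le_mul_of_nonneg_left he (mul_pos hE hE).le
    have h9 : Real.exp (-B) * Real.exp (-B) * (Real.exp B * d) = Real.exp (-B) * d := by
      linear_combination Real.exp (-B) * d * hEB
    linarith
  refine ⟨(closestReturn F q p (n + 2) x - x) / (closestReturn F q p n x - x), ?_, ?_,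
    (div_mul_cancel₀ _ hne).symm⟩
  · rcases h4 with ⟨h8, h9, h10⟩ | ⟨h8, h9, h10⟩
    · have := h6 h8
      apply div_nonneg <;> linarith
    · have := h6 h8
      apply div_nonneg_of_nonpos <;> linarith
  · rcases h4 with ⟨h8, h9, h10⟩ | ⟨h8, h9, h10⟩
    · have h11 := h6 h8
      have h12 := h7 h8
      rw [abs_of_pos (sub_pos.2 h8), abs_of_pos (sub_pos.2 h11)] at h1
      rw [abs_of_pos (sub_pos.2 h8), abs_of_pos (sub_pos.2 h12)] at h2
      rw [div_le_div_iff₀ (by linarith) (by positivity)]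
      rcases h5 with ⟨h13, h14, h15⟩ | ⟨h13, h14, h15⟩
      · linarith
      · have := key _ (closestReturn F q p (n + 2) x - x) _ h1 (by linarith)
        linarith
    · have h11 := h6 h8
      have h12 := h7 h8
      rw [abs_of_neg (sub_neg.2 h8), abs_of_neg (sub_neg.2 h11)] at h1
      rw [abs_of_neg (sub_neg.2 h8), abs_of_neg (sub_neg.2 h12)] at h2
      rw [← neg_div_neg_eq, div_le_div_iff₀ (by linarith) (by positivity)]
      rcases h5 with ⟨h13, h14, h15⟩ | ⟨h13, h14, h15⟩
      · have := key _ (-(closestReturn F q p (n + 2) x - x)) _ h1 (by linarith)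
        linarith
      · linarith

/-- Exponential decay of the return distances. -/
theorem exists_closestReturn_decay (h : IsDenjoyLift F φ ρ q p M) :
    ∃ μ, 0 < μ ∧ μ < 1 ∧ (∀ n x, |closestReturn F q p (n + 1) x - x| ≤ μ ^ n) ∧
      ∀ n x, ∃ θ, 0 ≤ θ ∧ θ ≤ μ ^ 2 ∧
        closestReturn F q p (n + 2) x - x = θ * (closestReturn F q p n x - x) := by
  obtain ⟨B, -, hB⟩ := h.exists_abs_birkhoffSum_le
  set l := 1 / (1 + Real.exp (-B) * Real.exp (-B)) with hl
  have hE : 0 < Real.exp (-B) * Real.exp (-B) := by positivity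
  have hl0 : 0 < l := by positivity
  have hl1 : l < 1 := by rw [hl, div_lt_one (by positivity)]; linarith
  have hsq : √l ^ 2 = l := Real.sq_sqrt hl0.le
  have hstep := h.closestReturn_add_two_sub hB
  refine ⟨√l, Real.sqrt_pos.2 hl0, by rw [Real.sqrt_lt' one_pos]; linarith, ?_, by rwa [hsq]⟩
  have hnext : ∀ n x, |closestReturn F q p (n + 2) x - x| ≤
      √l ^ 2 * |closestReturn F q p n x - x| := by
    intro n x
    obtain ⟨θ, h0, h1, h2⟩ := hstep n x
    rw [h2, hsq, abs_mul, abs_of_nonneg h0]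
    gcongr
  intro n
  induction n using Nat.strong_induction_on with
  | _ n ih =>
    intro x
    match n, ih with
    | 0, _ => simpa using abs_closestReturn_sub_le_one h.ordered h.convergents 1 x
    | 1, _ =>
      have h1 := hnext 0 x
      have h2 := abs_closestReturn_sub_le_one h.ordered h.convergents 0 x
      have h3 : √l ≤ 1 := Real.sqrt_le_one.2 hl1.le
      have h4 := Real.sqrt_nonneg l
      rw [pow_one]
      simp only [zero_add] at h1 ⊢
      nlinarith [abs_nonneg (closestReturn F q p 0 x - x)]
    | n + 2, ih =>
      have h1 := hnext (n + 1) x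
      have h2 := ih n (by omega) x
      calc |closestReturn F q p (n + 3) x - x| ≤ √l ^ 2 * √l ^ n := h1.trans (by gcongr)
        _ = √l ^ (n + 2) := by ring

end IsDenjoyLift

theorem abs_exp_sub_one_le_mul_exp {x c : ℝ} (hx : |x| ≤ c) :
    |Real.exp x - 1| ≤ Real.exp c * |x| := by
  obtain ⟨ξ, hξ, h⟩ := exists_sub_eq_deriv_mul Real.hasDerivAt_exp 0 x
  rw [Real.exp_zero, sub_zero] at h
  rw [h, abs_mul, Real.abs_exp]
  gcongr
  have := abs_sub_left_of_mem_uIcc hξ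
  simp only [sub_zero] at this
  exact (le_abs_self ξ).trans (this.trans hx)

namespace IsDenjoyLift

variable {F φ w : ℝ → ℝ} {ρ M B C : ℝ} {q p : ℕ → ℕ}

/-- On `[x, closestReturn n x]` the map `closestReturn (n + 1)` is almost Möbius, that is, its
derivative to the power `-1/2` is almost affine. -/
theorem exp_neg_half_almost_affine (h : IsDenjoyLift F φ ρ q p M) (hw : IsModulus w)
    (hC : 0 ≤ C) (hA : AlmostMoebius F φ w C)
    (hB : ∀ n x, |birkhoffSum F φ (q n) x| ≤ B) {Λ : ℝ} (hΛ : 0 < Λ) (hΛ1 : Λ ≤ 1) {n : ℕ}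
    (hret : ∀ x, |closestReturn F q p n x - x| ≤ Λ) (x : ℝ) {θ : ℝ} (hθ : 0 ≤ θ) (hθ1 : θ ≤ 1) :
    |Real.exp (-birkhoffSum F φ (q (n + 1)) (x + θ * (closestReturn F q p n x - x)) / 2) -
      ((1 - θ) * Real.exp (-birkhoffSum F φ (q (n + 1)) x / 2) +
        θ * Real.exp (-birkhoffSum F φ (q (n + 1)) (closestReturn F q p n x) / 2))| ≤
      4 * C * Real.exp (2 * C * w 1) * Real.exp (B / 2) * w Λ := by
  set b := closestReturn F q p n x with hb
  set t := x + θ * (b - x) with ht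
  set N := q (n + 1)
  have hbx : b - x ≠ 0 := sub_ne_zero.2 (closestReturn_ne h.ordered h.convergents n x)
  have hwΛ := hw.pos Λ hΛ
  have htm : t ∈ uIcc x b := by
    rw [mem_uIcc]
    rcases le_total x b with hxb | hxb
    · left; constructor <;> nlinarith
    · right; constructor <;> nlinarith
  have hsmall : ∀ c ∈ uIcc x b, ∀ d ∈ uIcc x b, ∃ ε, |ε| ≤ 2 * C * w Λ ∧
      F^[N] d - F^[N] c =
        (d - c) * Real.exp ((birkhoffSum F φ N c + birkhoffSum F φ N d) / 2 + ε) := by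
    intro c hc d hd
    obtain ⟨ε, h1, h2⟩ := hA.iterate hΛ hΛ1 N (a := c) (b := d) (fun i _ => by
      have hm := (h.strictMono.iterate i).monotone
      have h1 := closestReturn_iterate_add_int (q := q) (p := p) h.map_add_one n i x 0
      have h2 := hret (F^[i] x)
      simp only [Int.cast_zero, add_zero] at h1
      rw [h1, ← hb] at h2
      exact (abs_sub_le_of_uIcc_subset_uIcc (uIcc_subset_uIcc
        (hm.image_uIcc_subset (mem_image_of_mem _ hd))
        (hm.image_uIcc_subset (mem_image_of_mem _ hc)))).trans h2)
    refine ⟨ε, h1.trans ?_, h2⟩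
    have := sum_abs_iterate_sub_le h.strictMono h.map_add_one h.ordered h.convergents n hc hd
    calc C * w Λ * _ ≤ C * w Λ * 2 := by gcongr
      _ = _ := by ring
  obtain ⟨ε₁, h1, h1'⟩ := hsmall x left_mem_uIcc b right_mem_uIcc
  obtain ⟨ε₂, h2, h2'⟩ := hsmall x left_mem_uIcc t htm
  obtain ⟨ε₃, h3, h3'⟩ := hsmall t htm b right_mem_uIcc
  set X := birkhoffSum F φ N x
  set Y := birkhoffSum F φ N b
  set T := birkhoffSum F φ N t
  have hsum : Real.exp ((X + Y) / 2 + ε₁) =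
      θ * Real.exp ((X + T) / 2 + ε₂) + (1 - θ) * Real.exp ((T + Y) / 2 + ε₃) := by
    refine mul_left_cancel₀ hbx ?_
    rw [show t - x = θ * (b - x) by rw [ht]; ring] at h2'
    rw [show b - t = (1 - θ) * (b - x) by rw [ht]; ring] at h3'
    linarith
  have hbal : Real.exp (-T / 2) * Real.exp ε₁ =
      θ * (Real.exp (-Y / 2) * Real.exp ε₂) + (1 - θ) * (Real.exp (-X / 2) * Real.exp ε₃) := by
    have h4 := congrArg (fun z => Real.exp (-(X + Y + T) / 2) * z) hsum
    simp only [mul_add, mul_left_comm _ θ, mul_left_comm _ (1 - θ), ← Real.exp_add] at h4 ⊢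
    rw [show -(X + Y + T) / 2 + ((X + Y) / 2 + ε₁) = -T / 2 + ε₁ by ring,
      show -(X + Y + T) / 2 + ((X + T) / 2 + ε₂) = -Y / 2 + ε₂ by ring,
      show -(X + Y + T) / 2 + ((T + Y) / 2 + ε₃) = -X / 2 + ε₃ by ring] at h4
    exact h4
  have hexp : ∀ ε, |ε| ≤ 2 * C * w Λ →
      |Real.exp ε - 1| ≤ Real.exp (2 * C * w 1) * (2 * C * w Λ) := by
    intro ε hε
    have h4 : 2 * C * w Λ ≤ 2 * C * w 1 := by gcongr; exact hw.mono hΛ hΛ1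
    exact (abs_exp_sub_one_le_mul_exp (hε.trans h4)).trans (by gcongr)
  have hτ : ∀ z, Real.exp (-birkhoffSum F φ N z / 2) ≤ Real.exp (B / 2) := by
    intro z
    rw [Real.exp_le_exp]
    linarith [abs_le.1 (hB (n + 1) z)]
  have hprod : ∀ z ε, |ε| ≤ 2 * C * w Λ →
      |Real.exp (-birkhoffSum F φ N z / 2) * (Real.exp ε - 1)| ≤
        Real.exp (B / 2) * (Real.exp (2 * C * w 1) * (2 * C * w Λ)) := by
    intro z ε hε
    rw [abs_mul, Real.abs_exp]
    exact mul_le_mul (hτ z) (hexp ε hε) (abs_nonneg _) (Real.exp_pos _).le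
  have hT := abs_le.1 (hprod t ε₁ h1)
  have hY := abs_le.1 (hprod b ε₂ h2)
  have hX := abs_le.1 (hprod x ε₃ h3)
  have hid : Real.exp (-T / 2) - ((1 - θ) * Real.exp (-X / 2) + θ * Real.exp (-Y / 2)) =
      -(Real.exp (-T / 2) * (Real.exp ε₁ - 1)) + θ * (Real.exp (-Y / 2) * (Real.exp ε₂ - 1)) +
        (1 - θ) * (Real.exp (-X / 2) * (Real.exp ε₃ - 1)) := by
    linear_combination hbal
  have hθ2 : 0 ≤ 1 - θ := by linarith
  have e1 := mul_le_mul_of_nonneg_left hY.1 hθ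
  have e2 := mul_le_mul_of_nonneg_left hY.2 hθ
  have e3 := mul_le_mul_of_nonneg_left hX.1 hθ2
  have e4 := mul_le_mul_of_nonneg_left hX.2 hθ2
  rw [hid, abs_le]
  constructor <;> linarith

/-- The relative variation of `(closestReturn (n + 1))' ^ (-1/2)` over `[x, closestReturn n x]`. -/
noncomputable def returnVariation (F φ : ℝ → ℝ) (q p : ℕ → ℕ) (n : ℕ) (x : ℝ) : ℝ :=
  Real.exp (-birkhoffSum F φ (q (n + 1)) (closestReturn F q p n x) / 2) /
    Real.exp (-birkhoffSum F φ (q (n + 1)) x / 2) - 1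

theorem abs_returnVariation_succ_le (h : IsDenjoyLift F φ ρ q p M) (hw : IsModulus w)
    (hC : 0 ≤ C) (hA : AlmostMoebius F φ w C)
    (hB : ∀ n x, |birkhoffSum F φ (q n) x| ≤ B) {Λ l : ℝ} (hΛ : 0 < Λ) (hΛ1 : Λ ≤ 1) {n : ℕ}
    (hret : ∀ x, |closestReturn F q p n x - x| ≤ Λ) (x : ℝ) (hl : l ≤ 1)
    (hθ : ∃ θ, 0 ≤ θ ∧ θ ≤ l ∧
        closestReturn F q p (n + 2) x - x = θ * (closestReturn F q p n x - x)) :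
    |returnVariation F φ q p (n + 1) x| ≤ l * |returnVariation F φ q p n x| +
      4 * C * Real.exp (2 * C * w 1) * Real.exp (B / 2) * Real.exp (B / 2) * w Λ := by
  obtain ⟨θ, hθ0, hθl, hθ'⟩ := hθ
  have h1 := h.exp_neg_half_almost_affine hw hC hA hB hΛ hΛ1 hret x hθ0 (hθl.trans hl)
  rw [← hθ', add_sub_cancel] at h1
  have h2 := h.birkhoffSum_closestReturn_sub (n + 1 + 1) (n + 1) x
  have h3 : returnVariation F φ q p (n + 1) x =
      Real.exp (-birkhoffSum F φ (q (n + 1)) (closestReturn F q p (n + 2) x) / 2) /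
        Real.exp (-birkhoffSum F φ (q (n + 1)) x / 2) - 1 := by
    rw [returnVariation, ← Real.exp_sub, ← Real.exp_sub]
    congr 2
    linarith
  have hτ : 0 < Real.exp (-birkhoffSum F φ (q (n + 1)) x / 2) := Real.exp_pos _
  have hτ' : 1 ≤ Real.exp (B / 2) * Real.exp (-birkhoffSum F φ (q (n + 1)) x / 2) := by
    rw [← Real.exp_add, Real.one_le_exp_iff]
    linarith [abs_le.1 (hB (n + 1) x)]
  rw [h3, returnVariation]
  set a := Real.exp (-birkhoffSum F φ (q (n + 1)) x / 2)
  set b := Real.exp (-birkhoffSum F φ (q (n + 1)) (closestReturn F q p n x) / 2)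
  set c := Real.exp (-birkhoffSum F φ (q (n + 1)) (closestReturn F q p (n + 2) x) / 2)
  have hid : c / a - 1 = θ * (b / a - 1) + (c - ((1 - θ) * a + θ * b)) / a := by
    field_simp
    ring
  rw [hid]
  refine (abs_add_le _ _).trans (add_le_add ?_ ?_)
  · rw [abs_mul, abs_of_nonneg hθ0]
    gcongr
  · rw [abs_div, abs_of_pos hτ, div_le_iff₀ hτ]
    have := hw.pos Λ hΛ
    calc _ ≤ _ := h1
      _ ≤ _ := le_mul_of_one_le_right (by positivity) hτ'
      _ = _ := by ring

theorem abs_exp_birkhoffSum_sub_le (h : IsDenjoyLift F φ ρ q p M) (hw : IsModulus w)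
    (hC : 0 ≤ C) (hA : AlmostMoebius F φ w C)
    (hB : ∀ n x, |birkhoffSum F φ (q n) x| ≤ B) {Λ : ℝ} (hΛ : 0 < Λ) (hΛ1 : Λ ≤ 1) {n : ℕ}
    (hret : ∀ x, |closestReturn F q p n x - x| ≤ Λ) {x t : ℝ}
    (ht : t ∈ uIcc x (closestReturn F q p n x)) :
    |Real.exp (birkhoffSum F φ (q (n + 1)) t) - Real.exp (birkhoffSum F φ (q (n + 1)) x)| ≤
      2 * Real.exp (2 * B) * (1 + 4 * C * Real.exp (2 * C * w 1)) *
        (|returnVariation F φ q p n x| + w Λ) := by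
  have hbx : closestReturn F q p n x - x ≠ 0 :=
    sub_ne_zero.2 (closestReturn_ne h.ordered h.convergents n x)
  obtain ⟨θ, hθ0, hθ1, rfl⟩ : ∃ θ, 0 ≤ θ ∧ θ ≤ 1 ∧ t = x + θ * (closestReturn F q p n x - x) := by
    rw [← segment_eq_uIcc, segment_eq_image'] at ht
    obtain ⟨θ, hθ, rfl⟩ := ht
    exact ⟨θ, hθ.1, hθ.2, by simp⟩
  have h1 := h.exp_neg_half_almost_affine hw hC hA hB hΛ hΛ1 hret x hθ0 hθ1
  have hw0 := hw.pos Λ hΛ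
  set t := x + θ * (closestReturn F q p n x - x)
  have hB0 : 0 ≤ B := (abs_nonneg _).trans (hB 0 0)
  have hsq : ∀ z, Real.exp (birkhoffSum F φ (q (n + 1)) z) =
      Real.exp (birkhoffSum F φ (q (n + 1)) z / 2) ^ 2 := by
    intro z
    rw [← Real.exp_nat_mul]
    congr 1
    push_cast
    ring
  have hinv : ∀ z, Real.exp (birkhoffSum F φ (q (n + 1)) z / 2) *
      Real.exp (-birkhoffSum F φ (q (n + 1)) z / 2) = 1 := by
    intro z
    rw [← Real.exp_add, ← Real.exp_zero]
    congr 1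
    ring
  have hle : ∀ z, Real.exp (birkhoffSum F φ (q (n + 1)) z / 2) ≤ Real.exp (B / 2) := by
    intro z
    rw [Real.exp_le_exp]
    linarith [abs_le.1 (hB (n + 1) z)]
  rw [hsq, hsq, returnVariation]
  have hαa := hinv t
  have hβb := hinv x
  have hα := hle t
  have hβ := hle x
  have hα0 := Real.exp_pos (birkhoffSum F φ (q (n + 1)) t / 2)
  have hβ0 := Real.exp_pos (birkhoffSum F φ (q (n + 1)) x / 2)
  have hb0 := Real.exp_pos (-birkhoffSum F φ (q (n + 1)) x / 2)
  set α := Real.exp (birkhoffSum F φ (q (n + 1)) t / 2)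
  set β := Real.exp (birkhoffSum F φ (q (n + 1)) x / 2)
  set a := Real.exp (-birkhoffSum F φ (q (n + 1)) t / 2)
  set b := Real.exp (-birkhoffSum F φ (q (n + 1)) x / 2)
  set d := Real.exp (-birkhoffSum F φ (q (n + 1)) (closestReturn F q p n x) / 2)
  set K := Real.exp (2 * C * w 1)
  set e := Real.exp (B / 2) with he
  have he1 : 1 ≤ e := Real.one_le_exp (by linarith)
  have he4 : Real.exp (2 * B) = e ^ 4 := by
    rw [he, ← Real.exp_nat_mul]
    congr 1
    push_cast
    ring
  have hK : 0 < K := Real.exp_pos _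
  set r := d / b - 1 with hr
  have hd : d = (1 + r) * b := by rw [hr]; field_simp; ring
  set u := a - ((1 - θ) * b + θ * d) with hu
  have hid : α ^ 2 - β ^ 2 = (α + β) * (-(θ * r * α) - α * β * u) := by
    rw [hu, hd]
    linear_combination (α + β) * (β * hαa - α * hβb - θ * r * α * hβb)
  rw [hid, abs_mul, abs_of_pos (by positivity), he4]
  have h2 : |-(θ * r * α) - α * β * u| ≤ e * |r| + e * e * (4 * C * K * e * w Λ) := by
    refine (abs_sub _ _).trans (add_le_add ?_ ?_)
    · rw [abs_neg, abs_mul, abs_mul, abs_of_nonneg hθ0, abs_of_pos hα0]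
      have := mul_le_mul hα (mul_le_mul_of_nonneg_right hθ1 (abs_nonneg r)) (by positivity)
        (by positivity)
      linarith
    · rw [abs_mul, abs_mul, abs_of_pos hα0, abs_of_pos hβ0]
      gcongr
  have he3 : e ^ 2 ≤ e ^ 4 := pow_le_pow_right₀ he1 (by norm_num)
  calc _ ≤ (e + e) * (e * |r| + e * e * (4 * C * K * e * w Λ)) := by gcongr
    _ = 2 * (e ^ 2 * |r|) + 2 * e ^ 4 * (4 * C * K) * w Λ := by ring
    _ ≤ 2 * (e ^ 4 * |r|) + 2 * e ^ 4 * (4 * C * K) * w Λ := by gcongr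
    _ ≤ 2 * e ^ 4 * (1 + 4 * C * K) * (|r| + w Λ) := by
      have h3 : 0 ≤ e ^ 4 * w Λ := by positivity
      have h4 : 0 ≤ e ^ 4 * (4 * C * K) * |r| := by positivity
      nlinarith

theorem abs_closestReturn_succ_sub_le (h : IsDenjoyLift F φ ρ q p M)
    (hB : ∀ n x, |birkhoffSum F φ (q n) x| ≤ B) (n : ℕ) (x : ℝ) :
    |closestReturn F q p (n + 2) x - x| ≤
      Real.exp B * |closestReturn F q p (n + 1) x - x| := by
  have h1 := closestReturn_add_two h.map_add_one h.ordered h.convergents n x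
  have h2 := closestReturn_add_two h.map_add_one h.ordered h.convergents (n + 1) x
  have h3 := (h.closestReturn_ratio_bounds hB (n + 1) (closestReturn F q p (n + 2) x) x).1
  have h4 := closestReturn_strictMono (q := q) (p := p) h.strictMono (n + 1)
  have key : ∀ d e : ℝ, Real.exp (-B) * d ≤ e → d ≤ Real.exp B * e := by
    intro d e hde
    rw [Real.exp_neg, inv_mul_le_iff₀ (Real.exp_pos B)] at hde
    exact hde
  refine key _ _ (h3.trans ?_)
  rcases h1 with ⟨h5, h6, -⟩ | ⟨h5, h6, -⟩ <;> rcases h2 with ⟨h7, h8, h9⟩ | ⟨h7, h8, h9⟩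
  · linarith
  · rw [abs_of_pos (sub_pos.2 (h4 h6)), abs_of_neg (sub_neg.2 h5)]
    linarith
  · rw [abs_of_neg (sub_neg.2 (h4 h6)), abs_of_pos (sub_pos.2 h5)]
    linarith
  · linarith

theorem abs_exp_birkhoffSum_sub_one_mul_le (h : IsDenjoyLift F φ ρ q p M) (n : ℕ) {y o o' : ℝ}
    (ho : ∀ t ∈ uIcc y (closestReturn F q p n y),
      |Real.exp (birkhoffSum F φ (q (n + 1)) t) - Real.exp (birkhoffSum F φ (q (n + 1)) y)| ≤ o)
    (ho' : ∀ t ∈ uIcc y (closestReturn F q p (n + 1) y),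
      |Real.exp (birkhoffSum F φ (q (n + 2)) t) - Real.exp (birkhoffSum F φ (q (n + 2)) y)| ≤ o') :
    |Real.exp (birkhoffSum F φ (q (n + 2)) y) - 1| * |closestReturn F q p (n + 1) y - y| ≤
      (|Real.exp (birkhoffSum F φ (q (n + 1)) y) - 1| + o) * |closestReturn F q p (n + 2) y - y| +
        o' * |closestReturn F q p (n + 1) y - y| := by
  obtain ⟨ζ, hζ, hζ'⟩ := exists_sub_eq_deriv_mul
    (fun x => (h.hasDerivAt_closestReturn (n + 2) x).sub (hasDerivAt_id x)) y
      (closestReturn F q p (n + 1) y)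
  obtain ⟨ξ, hξ, hξ'⟩ := exists_sub_eq_deriv_mul
    (fun x => (h.hasDerivAt_closestReturn (n + 1) x).sub (hasDerivAt_id x)) y
      (closestReturn F q p (n + 2) y)
  have hcomm := closestReturn_comm (q := q) (p := p) h.map_add_one (n + 1) (n + 2) y
  have h1 := ho' ζ hζ
  have h2 := ho ξ (uIcc_subset_uIcc_left
    (closestReturn_add_two_mem h.strictMono h.map_add_one h.ordered h.convergents n y) hξ)
  simp only [Pi.sub_apply, id_eq] at hζ' hξ'
  set u := closestReturn F q p (n + 1) y - y
  set v := closestReturn F q p (n + 2) y - y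
  have heq : (Real.exp (birkhoffSum F φ (q (n + 2)) ζ) - 1) * u =
      (Real.exp (birkhoffSum F φ (q (n + 1)) ξ) - 1) * v := by
    rw [← hζ', ← hξ', hcomm]
    ring
  have hid : (Real.exp (birkhoffSum F φ (q (n + 2)) y) - 1) * u =
      (Real.exp (birkhoffSum F φ (q (n + 1)) y) - 1) * v +
      (Real.exp (birkhoffSum F φ (q (n + 1)) ξ) - Real.exp (birkhoffSum F φ (q (n + 1)) y)) * v -
      (Real.exp (birkhoffSum F φ (q (n + 2)) ζ) -
        Real.exp (birkhoffSum F φ (q (n + 2)) y)) * u := by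
    linear_combination heq
  rw [← abs_mul, hid]
  refine (abs_sub _ _).trans (add_le_add ((abs_add_le _ _).trans ?_) ?_)
  · rw [abs_mul, abs_mul, ← add_mul]
    gcongr
  · rw [abs_mul]
    gcongr

theorem abs_exp_birkhoffSum_sub_one_le (h : IsDenjoyLift F φ ρ q p M)
    (hB : ∀ n x, |birkhoffSum F φ (q n) x| ≤ B) {n : ℕ} {y l : ℝ} (hl : l ≤ 1)
    (hθ : ∃ θ, 0 ≤ θ ∧ θ ≤ l ∧
      closestReturn F q p (n + 3) y - y = θ * (closestReturn F q p (n + 1) y - y)) {o : ℕ → ℝ}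
    (ho : ∀ m, n ≤ m → ∀ t ∈ uIcc y (closestReturn F q p m y),
      |Real.exp (birkhoffSum F φ (q (m + 1)) t) -
        Real.exp (birkhoffSum F φ (q (m + 1)) y)| ≤ o m) :
    |Real.exp (birkhoffSum F φ (q (n + 3)) y) - 1| ≤
      l * |Real.exp (birkhoffSum F φ (q (n + 1)) y) - 1| +
        (o n + 2 * Real.exp B * o (n + 1) + o (n + 2)) := by
  obtain ⟨θ, hθ0, hθl, hθ'⟩ := hθ
  have ho0 : ∀ m, n ≤ m → 0 ≤ o m := fun m hm => (abs_nonneg _).trans (ho m hm y left_mem_uIcc)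
  have h1 := h.abs_exp_birkhoffSum_sub_one_mul_le n (ho n le_rfl) (ho (n + 1) (by omega))
  have h2 := h.abs_exp_birkhoffSum_sub_one_mul_le (n + 1) (ho (n + 1) (by omega))
    (ho (n + 2) (by omega))
  have h3 := h.abs_closestReturn_succ_sub_le hB (n + 1) y
  have hu : 0 < |closestReturn F q p (n + 1) y - y| :=
    abs_pos.2 (sub_ne_zero.2 (closestReturn_ne h.ordered h.convergents (n + 1) y))
  have hv : 0 < |closestReturn F q p (n + 2) y - y| :=
    abs_pos.2 (sub_ne_zero.2 (closestReturn_ne h.ordered h.convergents (n + 2) y))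
  have hz : |closestReturn F q p (n + 3) y - y| =
      θ * |closestReturn F q p (n + 1) y - y| := by
    rw [hθ', abs_mul, abs_of_nonneg hθ0]
  have e1 := ho0 n le_rfl
  have e2 := ho0 (n + 1) (by omega)
  have e3 := abs_nonneg (Real.exp (birkhoffSum F φ (q (n + 1)) y) - 1)
  have e4 := Real.exp_pos B
  simp only [Nat.add_assoc, Nat.reduceAdd] at h2 h3
  set u := |closestReturn F q p (n + 1) y - y|
  set v := |closestReturn F q p (n + 2) y - y|
  set z := |closestReturn F q p (n + 3) y - y|
  set E₁ := |Real.exp (birkhoffSum F φ (q (n + 1)) y) - 1|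
  set E₂ := |Real.exp (birkhoffSum F φ (q (n + 2)) y) - 1|
  set E₃ := |Real.exp (birkhoffSum F φ (q (n + 3)) y) - 1|
  refine le_of_mul_le_mul_right ?_ (mul_pos hv hu)
  calc E₃ * (v * u) = E₃ * v * u := by ring
    _ ≤ ((E₂ + o (n + 1)) * z + o (n + 2) * v) * u := by gcongr
    _ = E₂ * u * z + o (n + 1) * z * u + o (n + 2) * v * u := by ring
    _ ≤ ((E₁ + o n) * v + o (n + 1) * u) * z + o (n + 1) * z * u + o (n + 2) * v * u := by
      gcongr
    _ = (E₁ + o n) * v * (θ * u) + 2 * (o (n + 1) * u) * z + o (n + 2) * v * u := by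
      rw [hz]; ring
    _ ≤ (E₁ + o n) * v * (θ * u) + 2 * (o (n + 1) * u) * (Real.exp B * v) +
        o (n + 2) * v * u := by gcongr
    _ = (θ * E₁ + (θ * o n + 2 * Real.exp B * o (n + 1) + o (n + 2))) * (v * u) := by ring
    _ ≤ _ := by
      gcongr
      exact mul_le_of_le_one_left e1 (hθl.trans hl)

end IsDenjoyLift

theorem summable_of_le_mul_add {v β : ℕ → ℝ} {l : ℝ} {d : ℕ} (hv : ∀ n, 0 ≤ v n) (hl : l < 1)
    (hβ0 : ∀ n, 0 ≤ β n) (hβ : Summable β) (h : ∀ n, v (n + d) ≤ l * v n + β n) :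
    Summable v := by
  refine summable_of_sum_range_le (c := (∑ n ∈ Finset.range d, v n + ∑' n, β n) / (1 - l)) hv
    fun N => ?_
  rw [le_div_iff₀ (by linarith)]
  have h1 : ∑ n ∈ Finset.range N, v n ≤ ∑ n ∈ Finset.range (d + N), v n :=
    Finset.sum_le_sum_of_subset_of_nonneg (Finset.range_mono (by omega)) fun _ _ _ => hv _
  rw [Finset.sum_range_add] at h1
  have h2 : ∑ n ∈ Finset.range N, v (d + n) ≤ ∑ n ∈ Finset.range N, (l * v n + β n) :=
    Finset.sum_le_sum fun n _ => by rw [add_comm]; exact h n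
  rw [Finset.sum_add_distrib, ← Finset.mul_sum] at h2
  have h3 := hβ.sum_le_tsum (Finset.range N) fun n _ => hβ0 n
  linarith

theorem add_one_rpow_le_mul {ν : ℝ} (hν : 0 ≤ ν) (n d : ℕ) :
    ((n + d : ℕ) + 1 : ℝ) ^ ν ≤ (d + 1 : ℝ) ^ ν * (n + 1 : ℝ) ^ ν := by
  rw [← Real.mul_rpow (by positivity) (by positivity)]
  refine Real.rpow_le_rpow (by positivity) ?_ hν
  push_cast
  nlinarith [Nat.cast_nonneg (α := ℝ) n, Nat.cast_nonneg (α := ℝ) d,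
    mul_nonneg (Nat.cast_nonneg (α := ℝ) n) (Nat.cast_nonneg (α := ℝ) d)]

theorem eventually_mul_add_one_rpow_le {ν l l' : ℝ} (hν : 0 ≤ ν) (hl : 0 < l) (hll' : l < l')
    (d : ℕ) :
    ∀ᶠ n : ℕ in atTop, l * ((n + d : ℕ) + 1 : ℝ) ^ ν ≤ l' * (n + 1 : ℝ) ^ ν := by
  have h1 : Tendsto (fun n : ℕ => (1 + d / (n + 1 : ℝ)) ^ ν) atTop (𝓝 1) := by
    have h2 : Tendsto (fun n : ℕ => 1 + d / (n + 1 : ℝ)) atTop (𝓝 (1 + 0)) := by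
      refine tendsto_const_nhds.add (Tendsto.div_atTop tendsto_const_nhds ?_)
      exact tendsto_atTop_add_const_right _ _ tendsto_natCast_atTop_atTop
    simpa using h2.rpow_const (Or.inr hν)
  have h3 : 1 < l' / l := by rwa [one_lt_div hl]
  filter_upwards [h1.eventually_le_const h3] with n hn
  have h4 : ((n + d : ℕ) + 1 : ℝ) = (1 + d / (n + 1 : ℝ)) * (n + 1) := by
    push_cast
    field_simp
    ring
  rw [le_div_iff₀ hl] at hn
  rw [h4, Real.mul_rpow (by positivity) (by positivity)]
  have : (0 : ℝ) ≤ (n + 1 : ℝ) ^ ν := by positivity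
  nlinarith

/-- Families satisfying a contracting recursion with polynomially summable forcing are uniformly
dominated by a polynomially summable sequence. -/
theorem exists_summable_bound_of_recursion {X : Type*} [Nonempty X] {f : ℕ → X → ℝ} {b : ℕ → ℝ}
    {ν l A : ℝ} {d : ℕ} (hν : 0 ≤ ν) (hl0 : 0 < l) (hl : l < 1) (hf0 : ∀ n x, 0 ≤ f n x)
    (hfA : ∀ n x, f n x ≤ A) (hb0 : ∀ n, 0 ≤ b n)
    (hb : Summable fun n : ℕ => (n + 1 : ℝ) ^ ν * b n)
    (h : ∀ n x, f (n + d) x ≤ l * f n x + b n) :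
    ∃ s : ℕ → ℝ, (∀ n, 0 ≤ s n) ∧ (∀ n x, f n x ≤ s n) ∧
      Summable fun n : ℕ => (n + 1 : ℝ) ^ ν * s n := by
  have hbdd : ∀ n, BddAbove (range (f n)) := fun n => ⟨A, by rintro _ ⟨x, rfl⟩; exact hfA n x⟩
  have hle : ∀ n x, f n x ≤ ⨆ x, f n x := fun n x => le_ciSup (hbdd n) x
  have hs0 : ∀ n, 0 ≤ ⨆ x, f n x := fun n => Real.iSup_nonneg (hf0 n)
  refine ⟨fun n => ⨆ x, f n x, hs0, hle, ?_⟩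
  have hrec : ∀ n, ⨆ x, f (n + d) x ≤ l * (⨆ x, f n x) + b n := fun n =>
    ciSup_le fun x => (h n x).trans (by gcongr; exact hle n x)
  obtain ⟨l', hl', hl'1⟩ := exists_between hl
  obtain ⟨N, hN⟩ := eventually_atTop.1 (eventually_mul_add_one_rpow_le hν hl0 hl' d)
  rw [← summable_nat_add_iff N]
  refine summable_of_le_mul_add (d := d) (l := l')
    (β := fun n => (d + 1 : ℝ) ^ ν * (((n + N : ℕ) + 1 : ℝ) ^ ν * b (n + N)))
    (fun n => mul_nonneg (by positivity) (hs0 _)) hl'1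
    (fun n => mul_nonneg (by positivity) (mul_nonneg (by positivity) (hb0 _)))
    (((summable_nat_add_iff N).2 hb).mul_left _) fun n => ?_
  have h1 := hN (n + N) (by omega)
  have h2 := add_one_rpow_le_mul hν (n + N) d
  have h3 := hrec (n + N)
  have h4 := hs0 (n + N)
  have h5 := hb0 (n + N)
  rw [show n + d + N = n + N + d by ring]
  calc ((n + N + d : ℕ) + 1 : ℝ) ^ ν * ⨆ x, f (n + N + d) x
      ≤ ((n + N + d : ℕ) + 1 : ℝ) ^ ν * (l * (⨆ x, f (n + N) x) + b (n + N)) := by gcongr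
    _ = (l * ((n + N + d : ℕ) + 1 : ℝ) ^ ν) * (⨆ x, f (n + N) x) +
        ((n + N + d : ℕ) + 1 : ℝ) ^ ν * b (n + N) := by ring
    _ ≤ (l' * ((n + N : ℕ) + 1 : ℝ) ^ ν) * (⨆ x, f (n + N) x) +
        ((d + 1 : ℝ) ^ ν * ((n + N : ℕ) + 1 : ℝ) ^ ν) * b (n + N) := by gcongr
    _ = _ := by ring

/-- The integral condition on the modulus of continuity, as a series along a geometric
progression. -/
theorem IsModulus.summable_of_integrableOn {w : ℝ → ℝ} (hw : IsModulus w) {ν μ : ℝ} (hν : 0 ≤ ν)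
    (hμ0 : 0 < μ) (hμ1 : μ < 1)
    (hint : MeasureTheory.IntegrableOn
      (fun y : ℝ => (Real.log (1 / y)) ^ ν * w y / y) (Ioc 0 1)) :
    Summable fun n : ℕ => (n + 1 : ℝ) ^ ν * w (μ ^ n) := by
  set ℓ := Real.log (1 / μ) with hℓ
  have hℓ0 : 0 < ℓ := Real.log_pos (by rw [lt_div_iff₀ hμ0]; linarith)
  have hanti : ∀ {m n : ℕ}, m ≤ n → μ ^ n ≤ μ ^ m := fun h =>
    pow_le_pow_of_le_one hμ0.le hμ1.le h
  have hsub : ∀ n : ℕ, Ioc (μ ^ (n + 1)) (μ ^ n) ⊆ Ioc 0 1 := fun n =>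
    Ioc_subset_Ioc (by positivity) (pow_le_one₀ hμ0.le hμ1.le)
  have hdisj : Pairwise (Function.onFun Disjoint fun n : ℕ => Ioc (μ ^ (n + 1)) (μ ^ n)) := by
    intro m n hmn
    rw [Function.onFun, Set.disjoint_left]
    intro y hy hy'
    rcases lt_or_gt_of_ne hmn with h | h
    · linarith [hanti (show m + 1 ≤ n from h), hy.1, hy'.2]
    · linarith [hanti (show n + 1 ≤ m from h), hy'.1, hy.2]
  have hsum : Summable fun n : ℕ =>
      ∫ y in Ioc (μ ^ (n + 1)) (μ ^ n), (Real.log (1 / y)) ^ ν * w y / y := by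
    refine (MeasureTheory.hasSum_integral_iUnion (fun n => measurableSet_Ioc) hdisj
      (hint.mono_set (iUnion_subset hsub))).summable
  have hterm : ∀ n : ℕ, (1 - μ) * ℓ ^ ν * ((n : ℝ) ^ ν * w (μ ^ (n + 1))) ≤
      ∫ y in Ioc (μ ^ (n + 1)) (μ ^ n), (Real.log (1 / y)) ^ ν * w y / y := by
    intro n
    have hpow : 0 < μ ^ n := by positivity
    have hpow' : 0 < μ ^ (n + 1) := by positivity
    have hwp := hw.pos _ hpow'
    have h1 : ∫ y in Ioc (μ ^ (n + 1)) (μ ^ n), (n * ℓ) ^ ν * w (μ ^ (n + 1)) / μ ^ n =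
        (1 - μ) * ℓ ^ ν * ((n : ℝ) ^ ν * w (μ ^ (n + 1))) := by
      rw [MeasureTheory.setIntegral_const, Real.volume_real_Ioc_of_le (hanti n.le_succ),
        smul_eq_mul, Real.mul_rpow (Nat.cast_nonneg _) hℓ0.le, pow_succ]
      field_simp
    rw [← h1]
    refine MeasureTheory.setIntegral_mono_on (by simp) (hint.mono_set (hsub n))
      measurableSet_Ioc fun y hy => ?_
    have hy0 : 0 < y := hpow'.trans hy.1
    have hlog : n * ℓ ≤ Real.log (1 / y) := by
      rw [hℓ, ← Real.log_pow]
      refine Real.log_le_log (by positivity) ?_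
      rw [one_div_pow]
      exact one_div_le_one_div_of_le hy0 hy.2
    have hmono := hw.mono hpow' hy.1.le
    have hn : 0 ≤ n * ℓ := by positivity
    have := hn.trans hlog
    have := hw.pos y hy0
    gcongr
    exact hy.2
  have h1 : Summable fun n : ℕ => (1 - μ) * ℓ ^ ν * ((n : ℝ) ^ ν * w (μ ^ (n + 1))) :=
    Summable.of_nonneg_of_le (fun n => by
      have := hw.pos (μ ^ (n + 1)) (by positivity)
      have : 0 ≤ 1 - μ := by linarith
      positivity) hterm hsum
  rw [summable_mul_left_iff (mul_pos (by linarith) (by positivity)).ne',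
    ← summable_nat_add_iff 1] at h1
  rw [← summable_nat_add_iff 2]
  refine Summable.of_nonneg_of_le (fun n => ?_) (fun n => ?_) (h1.mul_left (2 ^ ν * 2 ^ ν))
  · have := hw.pos (μ ^ (n + 2)) (by positivity)
    positivity
  · have := hw.pos (μ ^ (n + 2)) (by positivity)
    rw [← mul_assoc, ← Real.mul_rpow (by norm_num) (by norm_num),
      ← Real.mul_rpow (by norm_num) (by positivity)]
    gcongr
    push_cast
    linarith

theorem abs_le_exp_mul_abs_exp_sub_one {x B : ℝ} (hx : |x| ≤ B) :
    |x| ≤ Real.exp B * |Real.exp x - 1| := by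
  obtain ⟨ξ, hξ, h⟩ := exists_sub_eq_deriv_mul Real.hasDerivAt_exp 0 x
  rw [Real.exp_zero, sub_zero] at h
  have h1 := abs_sub_left_of_mem_uIcc hξ
  simp only [sub_zero] at h1
  rw [h, abs_mul, Real.abs_exp, ← mul_assoc, ← Real.exp_add]
  refine le_mul_of_one_le_left (abs_nonneg _) (Real.one_le_exp ?_)
  linarith [neg_abs_le ξ]

namespace IsDenjoyLift

variable {F φ w : ℝ → ℝ} {ρ M B C ν : ℝ} {q p : ℕ → ℕ}

/-- The variations of `returnVariation` decay in a polynomially summable way. -/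
theorem exists_summable_bound_returnVariation (h : IsDenjoyLift F φ ρ q p M) (hw : IsModulus w)
    (hC : 0 ≤ C) (hA : AlmostMoebius F φ w C) (hν : 0 ≤ ν)
    (hB : ∀ n x, |birkhoffSum F φ (q n) x| ≤ B) {μ : ℝ} (hμ0 : 0 < μ) (hμ1 : μ < 1)
    (hdist : ∀ n x, |closestReturn F q p (n + 1) x - x| ≤ μ ^ n)
    (hθ : ∀ n x, ∃ θ, 0 ≤ θ ∧ θ ≤ μ ^ 2 ∧
        closestReturn F q p (n + 2) x - x = θ * (closestReturn F q p n x - x))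
    (hsum : Summable fun n : ℕ => (n + 1 : ℝ) ^ ν * w (μ ^ n)) :
    ∃ s : ℕ → ℝ, (∀ n, 0 ≤ s n) ∧ (∀ n x, |returnVariation F φ q p (n + 1) x| ≤ s n) ∧
      Summable fun n : ℕ => (n + 1 : ℝ) ^ ν * s n := by
  have hμ2 : μ ^ 2 < 1 := pow_lt_one₀ hμ0.le hμ1 two_ne_zero
  refine exists_summable_bound_of_recursion (d := 1) (l := μ ^ 2) (A := Real.exp B + 1)
    (b := fun n => 4 * C * Real.exp (2 * C * w 1) * Real.exp (B / 2) * Real.exp (B / 2) *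
      w (μ ^ n)) hν (by positivity) hμ2 (fun _ _ => abs_nonneg _) (fun n x => ?_) (fun n => ?_) ?_
    fun n x => ?_
  · rw [returnVariation, ← Real.exp_sub]
    refine (abs_sub _ _).trans ?_
    rw [Real.abs_exp, abs_one]
    gcongr
    have h1 := abs_le.1 (hB (n + 1 + 1) (closestReturn F q p (n + 1) x))
    have h2 := abs_le.1 (hB (n + 1 + 1) x)
    linarith
  · have := hw.pos (μ ^ n) (by positivity)
    positivity
  · refine (hsum.mul_left (4 * C * Real.exp (2 * C * w 1) * Real.exp (B / 2) *
      Real.exp (B / 2))).congr fun n => ?_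
    ring
  · exact h.abs_returnVariation_succ_le hw hC hA hB (by positivity)
      (pow_le_one₀ hμ0.le hμ1.le) (hdist n) x hμ2.le (hθ (n + 1) x)

/-- The logarithmic derivatives of the closest return maps are polynomially summable. -/
theorem exists_summable_bound_birkhoffSum (h : IsDenjoyLift F φ ρ q p M) (hw : IsModulus w)
    (hC : 0 ≤ C) (hA : AlmostMoebius F φ w C) (hν : 0 ≤ ν)
    (hint : MeasureTheory.IntegrableOn
      (fun y : ℝ => (Real.log (1 / y)) ^ ν * w y / y) (Ioc 0 1)) :
    ∃ s : ℕ → ℝ, (∀ n, 0 ≤ s n) ∧ (∀ n x, |birkhoffSum F φ (q n) x| ≤ s n) ∧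
      Summable fun n : ℕ => (n + 1 : ℝ) ^ ν * s n := by
  obtain ⟨B, hB0, hB⟩ := h.exists_abs_birkhoffSum_le
  obtain ⟨μ, hμ0, hμ1, hdist, hθ⟩ := h.exists_closestReturn_decay
  have hμ2 : μ ^ 2 < 1 := pow_lt_one₀ hμ0.le hμ1 two_ne_zero
  have hsum := hw.summable_of_integrableOn hν hμ0 hμ1 hint
  obtain ⟨s₁, hs₁0, hs₁, hs₁sum⟩ :=
    h.exists_summable_bound_returnVariation hw hC hA hν hB hμ0 hμ1 hdist hθ hsum
  have hwμ : ∀ n : ℕ, 0 < w (μ ^ n) := fun n => hw.pos _ (by positivity)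
  set A := 2 * Real.exp (2 * B) * (1 + 4 * C * Real.exp (2 * C * w 1)) with hA'
  have hA0 : 0 ≤ A := by positivity
  set σ : ℕ → ℝ := fun n => A * (s₁ n + w (μ ^ n)) with hσ
  have hσ0 : ∀ n, 0 ≤ σ n := fun n => mul_nonneg hA0 (add_nonneg (hs₁0 n) (hwμ n).le)
  have hσsum : Summable fun n : ℕ => (n + 1 : ℝ) ^ ν * σ n := by
    refine ((hs₁sum.add hsum).mul_left A).congr fun n => ?_
    rw [hσ]
    ring
  have hσsum' : ∀ d : ℕ, Summable fun n : ℕ => (n + 1 : ℝ) ^ ν * σ (n + d) := by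
    intro d
    refine Summable.of_nonneg_of_le (fun n => mul_nonneg (by positivity) (hσ0 _)) (fun n => ?_)
      ((summable_nat_add_iff d).2 hσsum)
    refine mul_le_mul_of_nonneg_right (Real.rpow_le_rpow (by positivity) ?_ hν) (hσ0 (n + d))
    push_cast
    linarith [Nat.cast_nonneg (α := ℝ) d]
  have hosc : ∀ n x, ∀ t ∈ uIcc x (closestReturn F q p (n + 1) x),
      |Real.exp (birkhoffSum F φ (q (n + 2)) t) - Real.exp (birkhoffSum F φ (q (n + 2)) x)| ≤
        σ n := by
    intro n x t ht
    refine (h.abs_exp_birkhoffSum_sub_le hw hC hA hB (by positivity)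
      (pow_le_one₀ hμ0.le hμ1.le) (hdist n) ht).trans ?_
    exact mul_le_mul_of_nonneg_left (add_le_add_left (hs₁ n x) _) hA0
  obtain ⟨s₂, hs₂0, hs₂, hs₂sum⟩ : ∃ s : ℕ → ℝ, (∀ n, 0 ≤ s n) ∧
      (∀ n x, |Real.exp (birkhoffSum F φ (q (n + 2)) x) - 1| ≤ s n) ∧
        Summable fun n : ℕ => (n + 1 : ℝ) ^ ν * s n := by
    refine exists_summable_bound_of_recursion (d := 2) (l := μ ^ 2) (A := Real.exp B + 1)
      (b := fun n => σ n + 2 * Real.exp B * σ (n + 1) + σ (n + 2)) hν (by positivity) hμ2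
      (fun _ _ => abs_nonneg _) (fun n x => ?_) (fun n => ?_) ?_ fun n x => ?_
    · refine (abs_sub _ _).trans ?_
      rw [Real.abs_exp, abs_one]
      gcongr
      exact (abs_le.1 (hB _ x)).2
    · have := hσ0 n
      have := hσ0 (n + 1)
      have := hσ0 (n + 2)
      positivity
    · refine ((hσsum.add ((hσsum' 1).mul_left (2 * Real.exp B))).add (hσsum' 2)).congr
        fun n => ?_
      ring
    · refine h.abs_exp_birkhoffSum_sub_one_le (n := n + 1) hB hμ2.le (hθ (n + 2) x)
        (o := fun m => σ (m - 1)) fun m hm t ht => ?_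
      obtain ⟨m, rfl⟩ : ∃ m', m = m' + 1 := ⟨m - 1, by omega⟩
      exact hosc m x t ht
  refine ⟨fun n => if n < 2 then B else Real.exp B * s₂ (n - 2), fun n => ?_, fun n x => ?_, ?_⟩
  · dsimp only
    split_ifs
    · exact hB0.le
    · exact mul_nonneg (Real.exp_pos _).le (hs₂0 _)
  · dsimp only
    split_ifs with hn
    · exact hB n x
    · obtain ⟨n, rfl⟩ : ∃ m, n = m + 2 := ⟨n - 2, by omega⟩
      exact (abs_le_exp_mul_abs_exp_sub_one (hB _ x)).trans (by gcongr; exact hs₂ n x)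
  · rw [← summable_nat_add_iff 2]
    refine Summable.of_nonneg_of_le (fun n => ?_) (fun n => ?_)
      (hs₂sum.mul_left (((2 : ℕ) + 1 : ℝ) ^ ν * Real.exp B))
    · have := hs₂0 n
      simp only [not_lt.2 (Nat.le_add_left 2 n), if_false, Nat.add_sub_cancel]
      positivity
    · have h1 := add_one_rpow_le_mul hν n 2
      have := hs₂0 n
      simp only [not_lt.2 (Nat.le_add_left 2 n), if_false, Nat.add_sub_cancel]
      calc _ ≤ (((2 : ℕ) + 1 : ℝ) ^ ν * (n + 1 : ℝ) ^ ν) * (Real.exp B * s₂ n) := by gcongr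
        _ = _ := by ring

end IsDenjoyLift

theorem abs_birkhoffSum_mul_le {F φ : ℝ → ℝ} {m : ℕ} {s : ℝ}
    (h : ∀ x, |birkhoffSum F φ m x| ≤ s) (a : ℕ) (x : ℝ) :
    |birkhoffSum F φ (m * a) x| ≤ a * s := by
  induction a with
  | zero => simp
  | succ a ih =>
    rw [Nat.mul_succ, birkhoffSum_add]
    refine (abs_add_le _ _).trans ((add_le_add ih (h _)).trans (le_of_eq ?_))
    push_cast
    ring

/-- Ostrowski expansion: a Birkhoff sum of any length is, up to the tail of a series, one of
finitely many Birkhoff sums. -/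
theorem exists_abs_birkhoffSum_sub_le_sum {F φ : ℝ → ℝ} {q κ : ℕ → ℕ} {s : ℕ → ℝ}
    (hq : ∀ n, 0 < q n) (hκ : ∀ n, q (n + 1) ≤ (κ n + 1) * q n) (hs0 : ∀ n, 0 ≤ s n)
    (hs : ∀ n x, |birkhoffSum F φ (q n) x| ≤ s n) {m n : ℕ} (hmn : m ≤ n) :
    ∀ N < q n, ∃ N₀ < q m, ∀ x, |birkhoffSum F φ N x - birkhoffSum F φ N₀ x| ≤
      ∑ j ∈ Finset.Ico m n, κ j * s j := by
  induction n, hmn using Nat.le_induction with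
  | base => exact fun N hN => ⟨N, hN, fun x => by simp⟩
  | succ n hmn ih =>
    intro N hN
    obtain ⟨N₀, hN₀, h⟩ := ih (N % q n) (Nat.mod_lt _ (hq n))
    refine ⟨N₀, hN₀, fun x => ?_⟩
    have ha : N / q n ≤ κ n :=
      Nat.lt_succ_iff.1 ((Nat.div_lt_iff_lt_mul (hq n)).2 (hN.trans_le (hκ n)))
    have h1 : birkhoffSum F φ N x = birkhoffSum F φ (N % q n) x +
        birkhoffSum F φ (q n * (N / q n)) (F^[N % q n] x) := by
      rw [← birkhoffSum_add, Nat.mod_add_div]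
    have h2 := abs_birkhoffSum_mul_le (hs n) (N / q n) (F^[N % q n] x)
    have h3 : ((N / q n : ℕ) : ℝ) * s n ≤ κ n * s n := by
      have := hs0 n
      gcongr
    rw [h1, Finset.sum_Ico_succ_top hmn, add_sub_right_comm]
    exact (abs_add_le _ _).trans (add_le_add (h x) (h2.trans h3))

/-- If the Birkhoff sums along the denominators `q n` are summable with the weights `κ n`, then all
Birkhoff sums are bounded and equicontinuous. -/
theorem birkhoffSum_bounded_and_equicontinuous {F φ : ℝ → ℝ} {q κ : ℕ → ℕ} {s : ℕ → ℝ}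
    (hq : ∀ n, 0 < q n) (hq' : ∀ n, n ≤ q n) (hκ : ∀ n, q (n + 1) ≤ (κ n + 1) * q n)
    (hs0 : ∀ n, 0 ≤ s n) (hs : ∀ n x, |birkhoffSum F φ (q n) x| ≤ s n)
    (hsum : Summable fun n => κ n * s n)
    (hbdd : ∀ n, ∃ B, ∀ x, |birkhoffSum F φ n x| ≤ B)
    (huc : ∀ n, UniformContinuous (birkhoffSum F φ n)) :
    (∃ B, ∀ n x, |birkhoffSum F φ n x| ≤ B) ∧
      ∀ ε > 0, ∃ δ > 0, ∀ n x y, |x - y| < δ →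
        |birkhoffSum F φ n x - birkhoffSum F φ n y| ≤ ε := by
  have hnn : ∀ n, 0 ≤ κ n * s n := fun n => mul_nonneg (Nat.cast_nonneg _) (hs0 n)
  have hsplit : ∀ m N, ∃ N₀ < q m, ∀ x, |birkhoffSum F φ N x - birkhoffSum F φ N₀ x| ≤
      ∑' j, (κ (j + m) : ℝ) * s (j + m) := by
    intro m N
    obtain ⟨N₀, hN₀, h⟩ := exists_abs_birkhoffSum_sub_le_sum hq hκ hs0 hs
      (show m ≤ m + (N + 1) by omega) N (lt_of_lt_of_le (by omega) (hq' (m + (N + 1))))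
    refine ⟨N₀, hN₀, fun x => (h x).trans ?_⟩
    rw [Finset.sum_Ico_eq_sum_range]
    simp only [add_comm m]
    exact ((summable_nat_add_iff m).2 hsum).sum_le_tsum _ fun j _ => hnn _
  constructor
  · choose b hb using hbdd
    have hb0 : ∀ n, 0 ≤ b n := fun n => (abs_nonneg _).trans (hb n 0)
    refine ⟨∑ j ∈ Finset.range (q 0), b j + ∑' j, (κ (j + 0) : ℝ) * s (j + 0),
      fun n x => ?_⟩
    obtain ⟨N₀, hN₀, h⟩ := hsplit 0 n
    have h1 := Finset.single_le_sum (fun j _ => hb0 j) (Finset.mem_range.2 hN₀)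
    have h2 := abs_sub_abs_le_abs_sub (birkhoffSum F φ n x) (birkhoffSum F φ N₀ x)
    linarith [h x, hb N₀ x]
  · intro ε hε
    obtain ⟨m, hm⟩ := ((tendsto_sum_nat_add fun j => (κ j : ℝ) * s j).eventually_lt_const
      (show (0 : ℝ) < ε / 3 by positivity)).exists
    have h1 : ∀ᶠ δ in 𝓝[>] (0 : ℝ), ∀ j ∈ Finset.range (q m), ∀ x y, |x - y| < δ →
        |birkhoffSum F φ j x - birkhoffSum F φ j y| < ε / 3 := by
      rw [Filter.eventually_all_finset]
      intro j _
      obtain ⟨δ, hδ, h⟩ := Metric.uniformContinuous_iff.1 (huc j) (ε / 3) (by positivity)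
      filter_upwards [Ioo_mem_nhdsGT hδ] with δ' hδ' x y hxy
      exact h (hxy.trans hδ'.2)
    obtain ⟨δ, hδ', hδ⟩ := (h1.and self_mem_nhdsWithin).exists
    refine ⟨δ, hδ, fun n x y hxy => ?_⟩
    obtain ⟨N₀, hN₀, h⟩ := hsplit m n
    have h2 := abs_le.1 (hδ' N₀ (Finset.mem_range.2 hN₀) x y hxy).le
    have h3 := abs_le.1 ((h x).trans hm.le)
    have h4 := abs_le.1 ((h y).trans hm.le)
    rw [abs_le]
    constructor <;> linarith

theorem Ultrafilter.exists_tendsto_of_abs_le (𝒰 : Ultrafilter ℕ) {u : ℕ → ℝ} {b : ℝ}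
    (hu : ∀ n, |u n| ≤ b) : ∃ L, Tendsto u 𝒰 (𝓝 L) := by
  obtain ⟨L, -, hL⟩ := (isCompact_Icc (a := -b) (b := b)).ultrafilter_le_nhds (𝒰.map u)
    (by
      rw [le_principal_iff]
      change u ⁻¹' Icc (-b) b ∈ 𝒰
      exact Filter.mem_of_superset Filter.univ_mem fun n _ => abs_le.1 (hu n))
  exact ⟨L, hL⟩

theorem abs_sum_div_le {u : ℕ → ℝ} {b : ℝ} (hb : 0 ≤ b) (hu : ∀ n, |u n| ≤ b) (N : ℕ) :
    |(∑ n ∈ Finset.range N, u n) / N| ≤ b := by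
  rw [abs_div, Nat.abs_cast]
  refine div_le_of_le_mul₀ (Nat.cast_nonneg _) hb ?_
  refine (Finset.abs_sum_le_sum_abs _ _).trans ?_
  have := Finset.sum_le_card_nsmul (Finset.range N) (fun n => |u n|) b fun n _ => hu n
  simpa [mul_comm] using this

/-- If the logarithmic derivatives of the iterates of a circle diffeomorphism are bounded and
equicontinuous, then the diffeomorphism is `C¹` conjugate to a rotation. -/
theorem exists_C1_conjugacy_of_equicontinuous {F φ : ℝ → ℝ} {ρ B : ℝ}
    (hF : ∀ x, HasDerivAt F (Real.exp (φ x)) x) (hFp : ∀ x, F (x + 1) = F x + 1)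
    (hrot : ∀ x : ℝ, Tendsto (fun n : ℕ => (F^[n] x - x) / (n : ℝ)) atTop (𝓝 ρ))
    (hB : ∀ n x, |birkhoffSum F φ n x| ≤ B)
    (hE : ∀ ε > 0, ∃ δ > 0, ∀ n x y, |x - y| < δ →
        |birkhoffSum F φ n x - birkhoffSum F φ n y| ≤ ε) :
    ∃ Φ Φ' : ℝ → ℝ, Continuous Φ' ∧ (∀ x, 0 < Φ' x) ∧ (∀ x, HasDerivAt Φ (Φ' x) x) ∧
      (∀ x, Φ (x + 1) = Φ x + 1) ∧ (∀ x, Φ (F x) = Φ x + ρ) := by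
  set 𝒰 : Ultrafilter ℕ := Ultrafilter.of atTop
  have h𝒰 : (𝒰 : Filter ℕ) ≤ atTop := Ultrafilter.of_le atTop
  set D : ℕ → ℝ → ℝ := fun n x => Real.exp (birkhoffSum F φ n x)
  set A : ℕ → ℝ → ℝ := fun N x => (∑ n ∈ Finset.range N, D n x) / N
  set P : ℕ → ℝ → ℝ := fun N x => (∑ n ∈ Finset.range N, (F^[n] x - F^[n] 0)) / N
  have hDle : ∀ n x, |D n x| ≤ Real.exp B := by
    intro n x
    rw [Real.abs_exp, Real.exp_le_exp]
    exact (abs_le.1 (hB n x)).2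
  have hDge : ∀ n x, Real.exp (-B) ≤ D n x := fun n x =>
    Real.exp_le_exp.2 (abs_le.1 (hB n x)).1
  have hMVT : ∀ n x y, ∃ ξ ∈ uIcc x y, F^[n] y - F^[n] x = D n ξ * (y - x) := fun n x y =>
    exists_sub_eq_deriv_mul (hasDerivAt_iterate_exp_birkhoffSum hF n) x y
  have hDE : ∀ ε > 0, ∃ δ > 0, ∀ n x y, |x - y| < δ → |D n x - D n y| ≤ ε := by
    intro ε hε
    obtain ⟨δ, hδ, h⟩ := hE (ε / Real.exp B) (by positivity)
    refine ⟨δ, hδ, fun n x y hxy => ?_⟩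
    obtain ⟨ξ, hξ, h1⟩ := exists_sub_eq_deriv_mul Real.hasDerivAt_exp
      (birkhoffSum F φ n y) (birkhoffSum F φ n x)
    have h2 : ξ ≤ B := hξ.2.trans
      (sup_le (abs_le.1 (hB n y)).2 (abs_le.1 (hB n x)).2)
    have h3 := h n x y hxy
    rw [le_div_iff₀ (Real.exp_pos B)] at h3
    simp only [D]
    rw [h1, abs_mul, Real.abs_exp, mul_comm]
    exact (mul_le_mul_of_nonneg_left (Real.exp_le_exp.2 h2) (abs_nonneg _)).trans h3
  have hA : ∀ x, ∃ L, Tendsto (fun N => A N x) 𝒰 (𝓝 L) := fun x =>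
    𝒰.exists_tendsto_of_abs_le (abs_sum_div_le (Real.exp_pos B).le fun n => hDle n x)
  have hP : ∀ x, ∃ L, Tendsto (fun N => P N x) 𝒰 (𝓝 L) := fun x =>
    𝒰.exists_tendsto_of_abs_le (abs_sum_div_le (b := Real.exp B * |x|) (by positivity) fun n => by
      obtain ⟨ξ, -, h⟩ := hMVT n 0 x
      rw [h, abs_mul, sub_zero]
      gcongr
      exact hDle n ξ)
  choose Φ' hΦ' using hA
  choose Φ hΦ using hP
  have hpos : ∀ᶠ N : ℕ in 𝒰, 0 < (N : ℝ) :=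
    h𝒰 ((eventually_gt_atTop 0).mono fun N hN => Nat.cast_pos.2 hN)
  refine ⟨Φ, Φ', ?_, fun x => ?_, fun x => ?_, fun x => ?_, fun x => ?_⟩
  · rw [Metric.continuous_iff]
    intro x ε hε
    obtain ⟨δ, hδ, h⟩ := hDE (ε / 2) (by positivity)
    refine ⟨δ, hδ, fun y hy => ?_⟩
    rw [Real.dist_eq] at hy ⊢
    refine lt_of_le_of_lt (le_of_tendsto ((hΦ' y).sub (hΦ' x)).abs
      (Eventually.of_forall fun N => ?_)) (half_lt_self hε)
    simp only [A, ← sub_div, ← Finset.sum_sub_distrib]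
    exact abs_sum_div_le (by positivity) (fun n => h n y x hy) N
  · refine (Real.exp_pos (-B)).trans_le (ge_of_tendsto (hΦ' x) (hpos.mono fun N hN => ?_))
    rw [le_div_iff₀ hN]
    have := Finset.card_nsmul_le_sum (Finset.range N) (fun n => D n x) _ fun n _ => hDge n x
    simpa [mul_comm] using this
  · rw [hasDerivAt_iff_isLittleO, Asymptotics.isLittleO_iff]
    intro ε hε
    obtain ⟨δ, hδ, h⟩ := hDE ε hε
    filter_upwards [Metric.ball_mem_nhds x hδ] with y hy
    rw [Metric.mem_ball, Real.dist_eq] at hy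
    rw [Real.norm_eq_abs, Real.norm_eq_abs, smul_eq_mul]
    refine le_of_tendsto (((hΦ y).sub (hΦ x)).sub ((hΦ' x).const_mul (y - x))).abs
      (Eventually.of_forall fun N => ?_)
    simp only [A, P, mul_div_assoc', Finset.mul_sum, ← sub_div, ← Finset.sum_sub_distrib]
    refine abs_sum_div_le (by positivity) (fun n => ?_) N
    obtain ⟨ξ, hξ, h1⟩ := hMVT n x y
    rw [sub_sub_sub_cancel_right, h1,
      show D n ξ * (y - x) - (y - x) * D n x = (D n ξ - D n x) * (y - x) by ring, abs_mul]
    gcongr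
    exact h n ξ x ((abs_sub_left_of_mem_uIcc hξ).trans_lt hy)
  · refine tendsto_nhds_unique (hΦ (x + 1)) (((hΦ x).add_const 1).congr' (hpos.mono fun N hN => ?_))
    have h1 : ∀ n, F^[n] (x + 1) - F^[n] 0 = (F^[n] x - F^[n] 0) + 1 := by
      intro n
      have := iterate_add_int hFp n x 1
      rw [Int.cast_one] at this
      rw [this]
      ring
    simp only [P, h1, Finset.sum_add_distrib, add_div]
    simp [hN.ne']
  · refine tendsto_nhds_unique (hΦ (F x)) (((hΦ x).add ((hrot x).mono_left h𝒰)).congr fun N => ?_)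
    simp only [P]
    rw [← add_div]
    congr 1
    have h1 := Finset.sum_range_sub (fun n => F^[n] x) N
    simp only [Function.iterate_succ_apply, Function.iterate_zero, id_eq] at h1
    rw [← h1, ← Finset.sum_add_distrib]
    exact Finset.sum_congr rfl fun n _ => by ring

theorem IsConvergents.le_apply {ρ : ℝ} {q p : ℕ → ℕ} (h : IsConvergents ρ q p) (n : ℕ) :
    n ≤ q n := by
  have h1 : ∀ n, n + 1 ≤ q (n + 1) := by
    intro n
    induction n with
    | zero => exact h.pos 1
    | succ n ih =>
      have := h.add_le n
      have := h.pos n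
      change n + 2 ≤ q (n + 2)
      omega
  rcases n with _ | n
  · exact Nat.zero_le _
  · exact h1 n

theorem UniformContinuous.birkhoffSum {F φ : ℝ → ℝ} (hF : UniformContinuous F)
    (hφ : UniformContinuous φ) (n : ℕ) : UniformContinuous (birkhoffSum F φ n) := by
  induction n with
  | zero =>
    rw [birkhoffSum_zero']
    exact uniformContinuous_const
  | succ n ih =>
    have h1 : UniformContinuous F^[n] := by
      clear ih
      induction n with
      | zero => exact uniformContinuous_id
      | succ n ih => exact ih.comp hF
    have h2 : _root_.birkhoffSum F φ (n + 1) =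
        fun x => _root_.birkhoffSum F φ n x + φ (F^[n] x) := by
      ext x
      rw [birkhoffSum_succ]
    rw [h2]
    exact ih.add (hφ.comp h1)

theorem uniformContinuous_of_abs_sub_le {f : ℝ → ℝ} {M : ℝ} (hM : 0 ≤ M)
    (h : ∀ x y, |f x - f y| ≤ M * |x - y|) : UniformContinuous f :=
  (LipschitzWith.of_dist_le_mul (K := ⟨M, hM⟩) fun x y => by
    rw [Real.dist_eq, Real.dist_eq]
    exact h x y).uniformContinuous

theorem abs_sub_le_of_abs_deriv_le {f f' : ℝ → ℝ} {M : ℝ} (hf : ∀ x, HasDerivAt f (f' x) x)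
    (h : ∀ x, |f' x| ≤ M) (x y : ℝ) : |f x - f y| ≤ M * |x - y| := by
  obtain ⟨ξ, -, hξ⟩ := exists_sub_eq_deriv_mul hf y x
  rw [hξ, abs_mul]
  gcongr
  exact h ξ

theorem summable_mul_of_polynomial_growth {k : ℕ → ℕ} {s : ℕ → ℝ} {ν c : ℝ} (hν : 0 ≤ ν)
    (hk : ∀ n : ℕ, 1 ≤ n → (k (n + 1) : ℝ) ≤ c * (n : ℝ) ^ ν) (hs0 : ∀ n, 0 ≤ s n)
    (hs : Summable fun n : ℕ => (n + 1 : ℝ) ^ ν * s n) :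
    Summable fun n => (k (n + 1) : ℝ) * s n := by
  rw [← summable_nat_add_iff 1] at hs ⊢
  refine Summable.of_nonneg_of_le (fun n => mul_nonneg (Nat.cast_nonneg _) (hs0 _)) (fun n => ?_)
    (hs.mul_left |c|)
  rw [← mul_assoc]
  refine mul_le_mul_of_nonneg_right ((hk (n + 1) (by omega)).trans ?_) (hs0 _)
  exact mul_le_mul (le_abs_self c)
    (Real.rpow_le_rpow (by positivity) (by linarith) hν) (by positivity) (abs_nonneg c)

end

/-- Polynomial-type rotation numbers: if `k_{n+1} ≤ c nᵛ` and
`∫₀¹ (log(1/y))ᵛ ϖ(y)/y dy < ∞`, then the `C_{2,ϖ}` diffeomorphism `T` admits a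
`C¹` conjugacy to `R_ρ`. -/
theorem C1_conjugacy_polynomial_type
    (w : ℝ → ℝ) (hw : IsModulus w)
    (F F' F'' : ℝ → ℝ) (hF : StrictMono F) (hFp : ∀ x, F (x + 1) = F x + 1)
    (hF' : ∀ x, HasDerivAt F (F' x) x) (hF'' : ∀ x, HasDerivAt F' (F'' x) x)
    (hF'pos : ∀ x, 0 < F' x)
    (hmod : ∀ x y : ℝ, x ≠ y → |F'' x - F'' y| ≤ w |x - y|)
    (ρ : ℝ) (hρ : ρ ∈ Set.Ioo (0:ℝ) 1) (hirr : Irrational ρ)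
    (hrot : ∀ x : ℝ,
      Filter.Tendsto (fun n : ℕ => (F^[n] x - x) / (n : ℝ)) Filter.atTop (nhds ρ))
    (k p q : ℕ → ℕ) (hk : ∀ n, 1 ≤ k (n + 1))
    (hp0 : p 0 = 0) (hp1 : p 1 = 1) (hq0 : q 0 = 1) (hq1 : q 1 = k 1)
    (hprec : ∀ n, p (n + 2) = k (n + 2) * p (n + 1) + p n)
    (hqrec : ∀ n, q (n + 2) = k (n + 2) * q (n + 1) + q n)
    (hconv : Filter.Tendsto (fun n => (p n : ℝ) / (q n : ℝ)) Filter.atTop (nhds ρ))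
    (ν c : ℝ) (hν : 0 < ν) (hc : 0 < c)
    (hkν : ∀ n : ℕ, 1 ≤ n → (k (n + 1) : ℝ) ≤ c * (n : ℝ) ^ ν)
    (hint : MeasureTheory.IntegrableOn
      (fun y : ℝ => (Real.log (1 / y)) ^ ν * w y / y) (Set.Ioc 0 1)) :
    ∃ Φ Φ' : ℝ → ℝ, Continuous Φ' ∧ (∀ x, 0 < Φ' x) ∧
      (∀ x, HasDerivAt Φ (Φ' x) x) ∧
      (∀ x, Φ (x + 1) = Φ x + 1) ∧
      (∀ x, Φ (F x) = Φ x + ρ) := by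
  set φ : ℝ → ℝ := fun x => Real.log (F' x) with hφ
  have hexp : ∀ x, F' x = Real.exp (φ x) := fun x => (Real.exp_log (hF'pos x)).symm
  have hFe : ∀ x, HasDerivAt F (Real.exp (φ x)) x := fun x => hexp x ▸ hF' x
  have hF'per : ∀ x, F' (x + 1) = F' x := hasDerivAt_periodic hF' hFp
  have hF''per : ∀ x, F'' (x + 1) = F'' x :=
    hasDerivAt_periodic (c := 0) hF'' fun x => by rw [hF'per, add_zero]
  have hcont' : Continuous F' := continuous_iff_continuousAt.2 fun x => (hF'' x).continuousAt
  have hcont'' : Continuous F'' := hw.continuous_of_forall hmod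
  have hφper : ∀ x, φ (x + 1) = φ x := fun x => by simp only [hφ, hF'per]
  have hφcont : Continuous φ := hcont'.log fun x => (hF'pos x).ne'
  obtain ⟨B, -, hB⟩ := exists_abs_le_of_periodic hφcont hφper
  obtain ⟨M, hM0, hM⟩ := exists_abs_le_of_periodic
    (hcont''.div hcont' fun x => (hF'pos x).ne') fun x => by
      simp only [Pi.div_apply, hF'per, hF''per]
  have hlip : ∀ x y, |φ x - φ y| ≤ M * |x - y| :=
    abs_sub_le_of_abs_deriv_le (fun x => (hF'' x).log (hF'pos x).ne') hM
  have hconvergents := isConvergents_of_recurrence hρ hk hp0 hp1 hq0 hq1 hprec hqrec hconv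
  have h : IsDenjoyLift F φ ρ q p M :=
    ⟨hF, hFp, orderedAsRotation_of_rotationNumber hF hFp hirr hrot, hconvergents, hFe, hφper, hlip⟩
  obtain ⟨C, hC, hA⟩ := almostMoebius_of_modulus hw hF' hF'' hmod hexp hB hlip
  obtain ⟨s, hs0, hs, hsum⟩ := h.exists_summable_bound_birkhoffSum hw hC hA hν.le hint
  have hκ : ∀ n, q (n + 1) ≤ (k (n + 1) + 1) * q n := by
    rintro (_ | n)
    · simp [hq1, hq0]
    · rw [hqrec, add_mul, one_mul]
      exact Nat.add_le_add_left (hconvergents.mono n) _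
  have hFuc : UniformContinuous F :=
    uniformContinuous_of_abs_sub_le (Real.exp_pos B).le
      (abs_sub_le_of_abs_deriv_le hFe fun x => by
        rw [Real.abs_exp]
        exact Real.exp_le_exp.2 (abs_le.1 (hB x)).2)
  obtain ⟨⟨b, hb⟩, hE⟩ := birkhoffSum_bounded_and_equicontinuous hconvergents.pos
    hconvergents.le_apply hκ hs0 hs (summable_mul_of_polynomial_growth hν.le hkν hs0 hsum)
    (fun n => (exists_abs_le_of_periodic (h.continuous_birkhoffSum n) fun x => by
      simpa using h.birkhoffSum_add_int n x 1).imp fun _ hx => hx.2)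
    (hFuc.birkhoffSum (uniformContinuous_of_abs_sub_le hM0.le hlip))
  exact exists_C1_conjugacy_of_equicontinuous hFe hFp hrot hb hE
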